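/- arXiv:1702.00320 — 3 statements merged into one kernel-verified Lean document; each statement's English description precedes it below -/
import Mathlib

section
/- Let γ be the infinite run of a 2-deterministic 2-automaton 𝒜 on two finite-state independent normal infinite words x and y. Let p be a state of 𝒜, let σ and σ′ be two transitions starting at p, and let (k_n)_{n≥0} be an increasing sequence of integers such that lim_{n→∞} occ(γ[1..k_n],p)/k_n exists and is strictly positive. Then lim_{n→∞} occ(γ[1..k_n],σ)/occ(γ[1..k_n],p) = lim_{n→∞} occ(γ[1..k_n],σ′)/occ(γ[1..k_n],p). -/
open Filter Topology

namespace FSI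

variable {A B D Q : Type*}

/-- The prefix of length `n` of the infinite word `x`. -/
def pref (x : ℕ → A) (n : ℕ) : List A := (List.range n).map x

/-- Number of (possibly overlapping) occurrences of `u` in `w`. -/
noncomputable def occ (w u : List A) : ℕ :=
  Nat.card {i : ℕ | i + u.length ≤ w.length ∧ (w.drop i).take u.length = u}

/-- Number of aligned occurrences of `u` in `w`. -/
noncomputable def alocc (w u : List A) : ℕ :=
  Nat.card {i : ℕ | i + u.length ≤ w.length ∧ i % u.length = 0 ∧ (w.drop i).take u.length = u}

/-- `x` is simply normal to word length `ℓ`. -/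
def SimplyNormalTo [Fintype A] (x : ℕ → A) (ℓ : ℕ) : Prop :=
  ∀ u : List A, u.length = ℓ →
    Tendsto (fun n : ℕ => (alocc (pref x (n * ℓ)) u : ℝ) / n) atTop
      (nhds ((Fintype.card A : ℝ)⁻¹ ^ ℓ))

/-- `x` is a normal infinite word. -/
def Normal [Fintype A] (x : ℕ → A) : Prop := ∀ ℓ : ℕ, 1 ≤ ℓ → SimplyNormalTo x ℓ

/-! ### Two-tape automata -/

/-- A `2`-automaton with input alphabets `A`, `B` and state set `Q`;
`none` plays the role of the empty word `ε` in transition labels. -/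
structure TwoAut (A B Q : Type*) where
  init : Set Q
  trans : Set (Q × (Option A × Option B) × Q)

/-- The support of a label. -/
def lsupp (l : Option A × Option B) : Bool × Bool := (l.1.isSome, l.2.isSome)

/-- A `2`-deterministic `2`-automaton. -/
def TwoAut.TwoDet (M : TwoAut A B Q) : Prop :=
  (∃ q₀, M.init = {q₀}) ∧
  ∀ t ∈ M.trans, ∀ t' ∈ M.trans, t.1 = t'.1 →
    lsupp t.2.1 = lsupp t'.2.1 ∧ (t.2.1 = t'.2.1 → t = t')

/-- A `1`-deterministic `2`-automaton. -/
def TwoAut.OneDet (M : TwoAut A B Q) : Prop :=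
  (∃ q₀, M.init = {q₀}) ∧
  ∀ t ∈ M.trans, ∀ t' ∈ M.trans, t.1 = t'.1 →
    t.2.1.1.isSome = t'.2.1.1.isSome ∧ (t.2.1.1 = t'.2.1.1 → t = t')

/-- `2`-completeness. -/
def TwoAut.TwoComplete (M : TwoAut A B Q) : Prop :=
  ∀ (q : Q) (l l' : Option A × Option B),
    (∃ q', (q, l, q') ∈ M.trans) → lsupp l' = lsupp l → ∃ q', (q, l', q') ∈ M.trans

/-- Every transition reads exactly one symbol. -/
def TwoAut.OneSymbol (M : TwoAut A B Q) : Prop :=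
  ∀ t ∈ M.trans, lsupp t.2.1 = (true, false) ∨ lsupp t.2.1 = (false, true)

def TwoAut.Step (M : TwoAut A B Q) (p q : Q) : Prop := ∃ l, (p, l, q) ∈ M.trans

/-- There is a finite run from `p` to `q`. -/
def TwoAut.Reaches (M : TwoAut A B Q) : Q → Q → Prop := Relation.ReflTransGen M.Step

def TwoAut.StronglyConnected (M : TwoAut A B Q) : Prop := ∀ p q, M.Reaches p q

/-- Word read on the first tape by the first `n` transitions of `γ`. -/
def in1 (γ : ℕ → Q × (Option A × Option B) × Q) (n : ℕ) : List A :=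
  ((List.range n).map fun i => (γ i).2.1.1).reduceOption

/-- Word read on the second tape by the first `n` transitions of `γ`. -/
def in2 (γ : ℕ → Q × (Option A × Option B) × Q) (n : ℕ) : List B :=
  ((List.range n).map fun i => (γ i).2.1.2).reduceOption

/-- `γ` is an infinite run of `M` (not necessarily from the initial state) whose
two input labels are the infinite words `x` and `y`. -/
def TwoAut.IsRunOn (M : TwoAut A B Q) (γ : ℕ → Q × (Option A × Option B) × Q)
    (x : ℕ → A) (y : ℕ → B) : Prop :=
  (∀ n, γ n ∈ M.trans) ∧ (∀ n, (γ n).2.2 = (γ (n + 1)).1) ∧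
  (∀ n, in1 γ n = pref x (in1 γ n).length) ∧ (∀ n, in2 γ n = pref y (in2 γ n).length) ∧
  Tendsto (fun n => (in1 γ n).length) atTop atTop ∧
  Tendsto (fun n => (in2 γ n).length) atTop atTop

/-- The pair `(x, y)` is accepted by `M`. -/
def TwoAut.Accepts (M : TwoAut A B Q) (x : ℕ → A) (y : ℕ → B) : Prop :=
  ∃ γ, (γ 0).1 ∈ M.init ∧ M.IsRunOn γ x y

/-- Number of occurrences of the state `q` among the first `n` transitions of `γ`. -/
noncomputable def stateCount (γ : ℕ → Q × (Option A × Option B) × Q) (q : Q) (n : ℕ) : ℕ :=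
  Nat.card {i : ℕ | i < n ∧ (γ i).1 = q}

/-- Number of occurrences of the transition `τ` among the first `n` transitions of `γ`. -/
noncomputable def transCount (γ : ℕ → Q × (Option A × Option B) × Q)
    (τ : Q × (Option A × Option B) × Q) (n : ℕ) : ℕ :=
  Nat.card {i : ℕ | i < n ∧ γ i = τ}

/-! ### Markov chain associated with a one-symbol automaton -/

/-- The `(p,q)` entry of the Markov matrix associated with the transition set `T`. -/
noncomputable def markovOf {S : Type*} [Fintype A] [Fintype B]
    (T : Set (S × (Option A × Option B) × S)) (p q : S) : ℝ :=
  (Nat.card {a : A | (p, (some a, none), q) ∈ T} : ℝ) / (Fintype.card A : ℝ) +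
  (Nat.card {b : B | (p, (none, some b), q) ∈ T} : ℝ) / (Fintype.card B : ℝ)

/-- `π` is a stationary distribution for the transition set `T` restricted to the
finite state set `st`. -/
def IsStationaryOn {S : Type*} [Fintype A] [Fintype B]
    (T : Set (S × (Option A × Option B) × S)) (st : Finset S) (π : S → ℝ) : Prop :=
  (∀ s ∈ st, 0 ≤ π s) ∧ (∑ s ∈ st, π s = 1) ∧
  ∀ q ∈ st, (∑ p ∈ st, π p * markovOf T p q) = π q

/-- `π` is a stationary distribution of the Markov chain associated with `M`. -/
def TwoAut.IsStationary [Fintype A] [Fintype B] [Fintype Q]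
    (M : TwoAut A B Q) (π : Q → ℝ) : Prop :=
  IsStationaryOn M.trans Finset.univ π

/-- The frequency property for the pair `(x, y)`: in every strongly connected
`2`-deterministic `2`-automaton (reading one symbol per transition), every infinite run
on a suffix of `x` and a suffix of `y` visits each state with frequency given by the
stationary distribution, and the automaton is `2`-complete. -/
def FreqProp [Fintype A] [Fintype B] (x : ℕ → A) (y : ℕ → B) : Prop :=
  ∀ (Q' : Type) [Fintype Q'] (M : TwoAut A B Q'), M.TwoDet → M.OneSymbol →
    M.StronglyConnected →
    ∀ (i j : ℕ) (γ : ℕ → Q' × (Option A × Option B) × Q'),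
      M.IsRunOn γ (fun n => x (n + i)) (fun n => y (n + j)) →
      M.TwoComplete ∧
      ∃ π : Q' → ℝ, M.IsStationary π ∧
        ∀ q, Tendsto (fun n : ℕ => (stateCount γ q n : ℝ) / n) atTop (nhds (π q))

/-! ### Conditional compressors (2-deterministic 3-automata) -/

/-- A `3`-automaton with two input tapes (alphabets `A` and `B`) and one
output tape (alphabet `D`), with a single initial state. -/
structure Comp3 (A B D Q : Type*) where
  init : Q
  trans : Set (Q × (Option A × Option B) × List D × Q)

/-- `2`-determinism for `3`-automata. -/
def Comp3.TwoDet (C : Comp3 A B D Q) : Prop :=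
  ∀ t ∈ C.trans, ∀ t' ∈ C.trans, t.1 = t'.1 →
    lsupp t.2.1 = lsupp t'.2.1 ∧ (t.2.1 = t'.2.1 → t = t')

def c3in1 (γ : ℕ → Q × (Option A × Option B) × List D × Q) (n : ℕ) : List A :=
  ((List.range n).map fun i => (γ i).2.1.1).reduceOption

def c3in2 (γ : ℕ → Q × (Option A × Option B) × List D × Q) (n : ℕ) : List B :=
  ((List.range n).map fun i => (γ i).2.1.2).reduceOption

def c3out (γ : ℕ → Q × (Option A × Option B) × List D × Q) (n : ℕ) : List D :=
  ((List.range n).map fun i => (γ i).2.2.1).flatten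

/-- `γ` is the accepting run of `C` on the pair `(x, y)`. -/
def Comp3.IsAccRunOn (C : Comp3 A B D Q) (γ : ℕ → Q × (Option A × Option B) × List D × Q)
    (x : ℕ → A) (y : ℕ → B) : Prop :=
  (γ 0).1 = C.init ∧ (∀ n, γ n ∈ C.trans) ∧ (∀ n, (γ n).2.2.2 = (γ (n + 1)).1) ∧
  (∀ n, c3in1 γ n = pref x (c3in1 γ n).length) ∧
  (∀ n, c3in2 γ n = pref y (c3in2 γ n).length) ∧
  Tendsto (fun n => (c3in1 γ n).length) atTop atTop ∧
  Tendsto (fun n => (c3in2 γ n).length) atTop atTop ∧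
  Tendsto (fun n => (c3out γ n).length) atTop atTop

/-- For every fixed second input `y`, the input-output map `x ↦ C(x,y)` is one-to-one. -/
def Comp3.OneToOne (C : Comp3 A B D Q) : Prop :=
  ∀ (x x' : ℕ → A) (y : ℕ → B) γ γ', C.IsAccRunOn γ x y → C.IsAccRunOn γ' x' y →
    (∀ n, ∃ m, c3out γ n <+: c3out γ' m) → (∀ n, ∃ m, c3out γ' n <+: c3out γ m) →
    x = x'

/-- The conditional compression ratio `ρ(x/y)`: the infimum, over all conditional
compressors, of the compression ratio of `x` given the oracle `y`. -/
noncomputable def condRho [Fintype A] [Fintype B] (x : ℕ → A) (y : ℕ → B) : ℝ :=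
  sInf {r : ℝ | ∃ (m d : ℕ), 2 ≤ d ∧ ∃ C : Comp3 A B (Fin d) (Fin m),
    C.TwoDet ∧ C.OneToOne ∧ ∃ γ, C.IsAccRunOn γ x y ∧
      r = Filter.liminf (fun n : ℕ =>
        (((c3out γ n).length : ℝ) * Real.log d) /
        (((c3in1 γ n).length : ℝ) * Real.log (Fintype.card A))) atTop}

/-! ### Compressors (one-to-one 1-deterministic 2-automata) -/

/-- A `2`-automaton with one input tape (alphabet `A`) and one output tape
(alphabet `D`), with a single initial state. -/
structure Comp2 (A D Q : Type*) where
  init : Q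
  trans : Set (Q × Option A × List D × Q)

def Comp2.OneDet (C : Comp2 A D Q) : Prop :=
  ∀ t ∈ C.trans, ∀ t' ∈ C.trans, t.1 = t'.1 →
    t.2.1.isSome = t'.2.1.isSome ∧ (t.2.1 = t'.2.1 → t = t')

def c2in (γ : ℕ → Q × Option A × List D × Q) (n : ℕ) : List A :=
  ((List.range n).map fun i => (γ i).2.1).reduceOption

def c2out (γ : ℕ → Q × Option A × List D × Q) (n : ℕ) : List D :=
  ((List.range n).map fun i => (γ i).2.2.1).flatten

def Comp2.IsAccRunOn (C : Comp2 A D Q) (γ : ℕ → Q × Option A × List D × Q)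
    (x : ℕ → A) : Prop :=
  (γ 0).1 = C.init ∧ (∀ n, γ n ∈ C.trans) ∧ (∀ n, (γ n).2.2.2 = (γ (n + 1)).1) ∧
  (∀ n, c2in γ n = pref x (c2in γ n).length) ∧
  Tendsto (fun n => (c2in γ n).length) atTop atTop ∧
  Tendsto (fun n => (c2out γ n).length) atTop atTop

def Comp2.OneToOne (C : Comp2 A D Q) : Prop :=
  ∀ (x x' : ℕ → A) γ γ', C.IsAccRunOn γ x → C.IsAccRunOn γ' x' →
    (∀ n, ∃ m, c2out γ n <+: c2out γ' m) → (∀ n, ∃ m, c2out γ' n <+: c2out γ m) →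
    x = x'

/-- The compression ratio `ρ(x)`. -/
noncomputable def rho [Fintype A] (x : ℕ → A) : ℝ :=
  sInf {r : ℝ | ∃ (m d : ℕ), 2 ≤ d ∧ ∃ C : Comp2 A (Fin d) (Fin m),
    C.OneDet ∧ C.OneToOne ∧ ∃ γ, C.IsAccRunOn γ x ∧
      r = Filter.liminf (fun n : ℕ =>
        (((c2out γ n).length : ℝ) * Real.log d) /
        (((c2in γ n).length : ℝ) * Real.log (Fintype.card A))) atTop}

/-- Finite-state independence. -/
def FSIndep [Fintype A] [Fintype B] (x : ℕ → A) (y : ℕ → B) : Prop :=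
  condRho x y = rho x ∧ condRho y x = rho y ∧ 0 < rho x ∧ 0 < rho y

/-! ### Oblivious selectors with two input tapes -/

/-- Types of states of a selector. -/
inductive SelTy | I | II | III

/-- An oblivious selector with first input alphabet `A` and second input alphabet `B`:
at a state of type I it reads the next symbol of the first input and selects it, at a
state of type II it reads the next symbol of the first input without selecting it, and
at a state of type III it reads the next symbol of the second input. -/
structure Sel2 (A B : Type*) where
  states : ℕ
  init : Fin states
  ty : Fin states → SelTy
  δa : Fin states → A → Fin states
  δb : Fin states → B → Fin states

/-- Configuration (current state, symbols read from `x`, symbols read from `y`)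
after `n` steps. -/
def Sel2.cfg (S : Sel2 A B) (x : ℕ → A) (y : ℕ → B) : ℕ → Fin S.states × ℕ × ℕ
  | 0 => (S.init, 0, 0)
  | n + 1 =>
    let c := S.cfg x y n
    match S.ty c.1 with
    | SelTy.I => (S.δa c.1 (x c.2.1), c.2.1 + 1, c.2.2)
    | SelTy.II => (S.δa c.1 (x c.2.1), c.2.1 + 1, c.2.2)
    | SelTy.III => (S.δb c.1 (y c.2.2), c.2.1, c.2.2 + 1)

/-- The word selected from `x` during the first `n` steps. -/
def Sel2.outList (S : Sel2 A B) (x : ℕ → A) (y : ℕ → B) (n : ℕ) : List A :=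
  (List.range n).filterMap fun i =>
    let c := S.cfg x y i
    match S.ty c.1 with
    | SelTy.I => some (x c.2.1)
    | SelTy.II => none
    | SelTy.III => none

/-! ### Oblivious one-input selection automata -/

/-- An oblivious selection automaton with a single input tape. -/
structure Sel1 (B : Type*) where
  states : ℕ
  init : Fin states
  sel : Fin states → Bool
  δ : Fin states → B → Fin states

/-- State after reading the first `n` symbols of `y`. -/
def Sel1.st (S : Sel1 B) (y : ℕ → B) : ℕ → Fin S.states
  | 0 => S.init
  | n + 1 => S.δ (S.st y n) (y n)

/-- The word selected from the first `n` symbols of `y`. -/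
def Sel1.outList (S : Sel1 B) (y : ℕ → B) (n : ℕ) : List B :=
  (List.range n).filterMap fun i => if S.sel (S.st y i) then some (y i) else none

/-! ### Shufflers -/

/-- A shuffler over the alphabet `A`: at a state of type I it reads, outputs and moves
on the next symbol of the first input; at a state of type II it does so with the second
input. -/
structure Shuffler (A : Type*) where
  states : ℕ
  init : Fin states
  tyI : Fin states → Bool
  δ : Fin states → A → Fin states

/-- Configuration (current state, symbols read from `x`, symbols read from `y`)
after `n` steps. -/
def Shuffler.cfg (S : Shuffler A) (x y : ℕ → A) : ℕ → Fin S.states × ℕ × ℕ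
  | 0 => (S.init, 0, 0)
  | n + 1 =>
    let c := S.cfg x y n
    if S.tyI c.1 then (S.δ c.1 (x c.2.1), c.2.1 + 1, c.2.2)
    else (S.δ c.1 (y c.2.2), c.2.1, c.2.2 + 1)

/-- The output `S(x,y)` of the shuffler `S` on inputs `x` and `y`. -/
def Shuffler.out (S : Shuffler A) (x y : ℕ → A) (n : ℕ) : A :=
  let c := S.cfg x y n
  if S.tyI c.1 then x c.2.1 else y c.2.2

/-! ### Look-ahead automata -/

/-- The transitions of the look-ahead automaton `𝒜_{k,ℓ}`. -/
def lookTrans (M : TwoAut A B Q) (k ℓ : ℕ) :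
    Set ((Q × List A × List B) × (Option A × Option B) × (Q × List A × List B)) :=
  {t | (∃ (q : Q) (u : List A) (a : A), u.length < k ∧
          t = ((q, u, []), (some a, none), (q, u ++ [a], ([] : List B)))) ∨
       (∃ (q : Q) (u : List A) (v : List B) (b : B), u.length = k ∧ v.length < ℓ ∧
          t = ((q, u, v), (none, some b), (q, u, v ++ [b]))) ∨
       (∃ (q q' : Q) (a a' : A) (u' : List A) (v : List B),
          u'.length = k - 1 ∧ v.length = ℓ ∧ (q, (some a, none), q') ∈ M.trans ∧
          t = ((q, a :: u', v), (some a', none), (q', u' ++ [a'], v))) ∨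
       (∃ (q q' : Q) (b b' : B) (u : List A) (v' : List B),
          u.length = k ∧ v'.length = ℓ - 1 ∧ (q, (none, some b), q') ∈ M.trans ∧
          t = ((q, u, b :: v'), (none, some b'), (q', u, v' ++ [b'])))}

/-- The (finite) set of states of the look-ahead automaton with full buffers,
i.e. `Q × A^k × B^ℓ`. -/
noncomputable def fullFinset (Q A B : Type*) [Fintype Q] [Fintype A] [Fintype B]
    (k ℓ : ℕ) : Finset (Q × List A × List B) :=
  letI := Classical.decEq (Q × List A × List B)
  (Finset.univ : Finset (Q × (Fin k → A) × (Fin ℓ → B))).image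
    fun s => (s.1, List.ofFn s.2.1, List.ofFn s.2.2)

/-! ### Counting words and measures -/

/-- The number of words of length `n` with exactly `i` occurrences of `γ`. -/
noncomputable def Ncount (γ : List A) (i n : ℕ) : ℕ :=
  Nat.card {w : List A // w.length = n ∧ occ w γ = i}

/-- The cylinder of infinite words starting with `w`. -/
def cylinder (w : List A) : Set (ℕ → A) := {x : ℕ → A | pref x w.length = w}

/-- The set `E_S(ε,γ,n)` of pairs of inputs for which the frequency of `γ` in the first
`n` symbols of `S(x,y)` deviates from `|A|^{-|γ|}` by less than `ε`. -/
def Eset [Fintype A] (S : Shuffler A) (ε : ℝ) (γ : List A) (n : ℕ) :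
    Set ((ℕ → A) × (ℕ → A)) :=
  {p : (ℕ → A) × (ℕ → A) |
    |(occ (pref (S.out p.1 p.2) n) γ : ℝ) - (n : ℝ) / (Fintype.card A : ℝ) ^ γ.length|
      < ε * n}

/-- The set `F(ε,t,ℓ,n)`. -/
def Fset [Fintype A] (S : ℕ → Shuffler A) (ε : ℝ) (t ℓ n : ℕ) :
    Set ((ℕ → A) × (ℕ → A)) :=
  ⋂ i ∈ Finset.Icc 1 t, ⋂ r ∈ Finset.Icc 1 ℓ,
    ⋂ γ ∈ {γ : List A | γ.length = r}, Eset (S i) ε γ n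

/-- `ℓ_n = (log_{|A|} n)/3`. -/
noncomputable def ellSeq (A : Type*) [Fintype A] (n : ℕ) : ℝ :=
  Real.logb (Fintype.card A) n / 3

/-- `ε_n = 2 √((log n · log_{|A|} n)/n)`. -/
noncomputable def epsSeq (A : Type*) [Fintype A] (n : ℕ) : ℝ :=
  2 * Real.sqrt (Real.log n * Real.logb (Fintype.card A) n / n)

/-- `F_n = F(ε_n, t_n, ℓ_n, n)` with `t_n = n`. -/
noncomputable def Fn [Fintype A] (S : ℕ → Shuffler A) (n : ℕ) :
    Set ((ℕ → A) × (ℕ → A)) :=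
  Fset S (epsSeq A n) n (⌊ellSeq A n⌋).toNat n

/-- `n_start`, the least `n` such that `ε_n ≥ 6/⌊n/ℓ_n⌋`. -/
noncomputable def nStart (A : Type*) [Fintype A] : ℕ :=
  sInf {m : ℕ | 0 < ⌊(m : ℝ) / ellSeq A m⌋ ∧
    6 / ((⌊(m : ℝ) / ellSeq A m⌋ : ℤ) : ℝ) ≤ epsSeq A m}

/-- `G_n = ⋂_{j=0}^{n} F_{|A|^{n_0+j}}` where `|A|^{n_0} = n_start`. -/
noncomputable def Gn [Fintype A] (S : ℕ → Shuffler A) (n : ℕ) :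
    Set ((ℕ → A) × (ℕ → A)) :=
  ⋂ j ∈ Finset.range (n + 1), Fn S (nStart A * Fintype.card A ^ j)

/-! ### Prefix codes for short words -/

/-- A prefix-free code with prescribed codeword lengths `h + L v`, obtained by writing `L v` in a
header of length `h` and then the rank of `v` among the elements of the same length. -/
theorem exists_prefixFree_code {V : Type*} [Fintype V] {d : ℕ} (L : V → ℕ) (h : ℕ)
    (hcount : ∀ j, Nat.card {v // L v = j} ≤ d ^ j) (hL : ∀ v, L v < d ^ h) :
    ∃ c : V → List (Fin d), (∀ v, (c v).length = h + L v) ∧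
      ∀ v v', c v <+: c v' → v = v' := by
  classical
  have header : Nonempty (Fin (d ^ h) ↪ (Fin h → Fin d)) :=
    Function.Embedding.nonempty_of_card_le (by simp)
  have index : ∀ j, Nonempty ({v // L v = j} ↪ (Fin j → Fin d)) := fun j =>
    Function.Embedding.nonempty_of_card_le (by
      have := hcount j
      rw [Nat.card_eq_fintype_card] at this
      simpa using this)
  obtain ⟨f⟩ := header
  have g := fun j => (index j).some
  refine ⟨fun v => List.ofFn (f ⟨L v, hL v⟩) ++ List.ofFn (g (L v) ⟨v, rfl⟩), by simp, ?_⟩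
  intro v v' hp
  have hh : List.ofFn (f ⟨L v, hL v⟩) = List.ofFn (f ⟨L v', hL v'⟩) := by
    have h1 : List.ofFn (f ⟨L v, hL v⟩) <+: _ := (List.prefix_append _ _).trans hp
    have h2 : List.ofFn (f ⟨L v', hL v'⟩) <+: _ :=
      List.prefix_append _ (List.ofFn (g (L v') ⟨v', rfl⟩))
    exact (List.prefix_of_prefix_length_le h1 h2 (by simp)).eq_of_length (by simp)
  have hLL : L v = L v' := by
    have := f.injective (List.ofFn_injective hh)
    simpa using this
  dsimp only at hp
  rw [hh, List.prefix_append_right_inj] at hp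
  have key : ∀ (j j' : ℕ) (h1 : L v = j) (h2 : L v' = j'), j = j' →
      List.ofFn (g j ⟨v, h1⟩) <+: List.ofFn (g j' ⟨v', h2⟩) → v = v' := by
    rintro j _ h1 h2 rfl hab
    simpa using (g j).injective (List.ofFn_injective (hab.eq_of_length (by simp)))
  exact key _ _ rfl rfl hLL hp

theorem card_le_of_kraft {V : Type*} [Fintype V] {d : ℕ} (hd : 0 < d) (μ : V → ℝ)
    (hμ : ∀ v, 0 ≤ μ v) (hsum : ∑ v, μ v ≤ 1) (L : V → ℕ)
    (hL : ∀ v, ((d : ℝ) ^ L v)⁻¹ ≤ μ v) (j : ℕ) :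
    Nat.card {v // L v = j} ≤ d ^ j := by
  classical
  rw [Nat.card_eq_fintype_card, Fintype.card_subtype]
  have h1 : ∑ v ∈ Finset.univ.filter (fun v => L v = j), ((d : ℝ) ^ j)⁻¹ ≤ 1 := by
    calc _ ≤ ∑ v ∈ Finset.univ.filter (fun v => L v = j), μ v := by
          apply Finset.sum_le_sum
          intro v hv
          rw [← (Finset.mem_filter.mp hv).2]
          exact hL v
      _ ≤ ∑ v, μ v := Finset.sum_le_sum_of_subset_of_nonneg (Finset.filter_subset _ _)
          (fun v _ _ => hμ v)
      _ ≤ 1 := hsum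
  have hdj : (0 : ℝ) < (d : ℝ) ^ j := by positivity
  rw [Finset.sum_const, nsmul_eq_mul, ← div_eq_mul_inv, div_le_one hdj] at h1
  exact_mod_cast h1

/-- Given a positive probability vector `g` on `A`, words of length at most `ℓ` have a prefix-free
code whose lengths exceed `-log g` by an overhead that is at most `ε * ℓ`. -/
theorem exists_block_code [Fintype A] (d : ℕ) (hd : 2 ≤ d) (g : A → ℝ) (hg : ∀ a, 0 < g a)
    (hg1 : ∀ a, g a ≤ 1) (hsum : ∑ a, g a = 1) (ε : ℝ) (hε : 0 < ε) :
    ∃ (ℓ : ℕ) (H : ℝ) (code : List A → List (Fin d)), 1 ≤ ℓ ∧ 0 ≤ H ∧ H ≤ ε * ℓ ∧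
      (∀ l : List A, l.length ≤ ℓ →
        1 ≤ (code l).length ∧
        ((code l).length : ℝ) ≤ H + (l.map fun a => -Real.logb d (g a)).sum) ∧
      ∀ l l' : List A, l.length ≤ ℓ → l'.length ≤ ℓ → code l <+: code l' → l = l' := by
  classical
  have hd1 : (1 : ℝ) < d := by exact_mod_cast (by omega : 1 < d)
  have ht : ∀ a, 0 ≤ -Real.logb d (g a) := fun a => by
    have := Real.logb_nonpos hd1 (hg a).le (hg1 a)
    linarith
  obtain ⟨C, hC⟩ : ∃ C : ℕ, ∀ a, -Real.logb d (g a) ≤ C := by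
    obtain ⟨C, hC⟩ := (Set.finite_range fun a => -Real.logb d (g a)).bddAbove
    obtain ⟨n, hn⟩ := exists_nat_ge C
    exact ⟨n, fun a => (hC ⟨a, rfl⟩).trans hn⟩
  have hpow : ∀ k : ℕ, ∀ K > (0 : ℝ), ∀ᶠ h : ℕ in atTop, K * (h : ℝ) ^ k ≤ (2 : ℝ) ^ h := by
    intro k K hK
    have := (tendsto_pow_const_div_const_pow_of_one_lt k (one_lt_two (α := ℝ))).eventually
      (gt_mem_nhds (inv_pos.mpr hK))
    filter_upwards [this] with h hh
    have h2 : (0 : ℝ) < 2 ^ h := by positivity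
    rw [div_lt_iff₀ h2, inv_mul_eq_div, lt_div_iff₀ hK] at hh
    linarith
  obtain ⟨h, h1, h2, h3, h4⟩ : ∃ h : ℕ, 1 ≤ h ∧ (h : ℝ) ^ 2 + 1 ≤ 2 ^ h ∧
      (h : ℝ) ^ 2 * C + h + 2 ≤ 2 ^ h ∧ 2 * (h : ℝ) + 1 ≤ ε * h ^ 2 := by
    have e4 : ∀ᶠ h : ℕ in atTop, 3 / ε ≤ (h : ℝ) := tendsto_natCast_atTop_atTop.eventually_ge_atTop _
    obtain ⟨h, a, b, c⟩ := ((eventually_ge_atTop 1).and ((hpow 2 (C + 3) (by positivity)).and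
      e4)).exists
    have a' : (1 : ℝ) ≤ h := by exact_mod_cast a
    refine ⟨h, a, by nlinarith [Nat.cast_nonneg (α := ℝ) C], by nlinarith, ?_⟩
    rw [div_le_iff₀ hε] at c
    nlinarith
  set ℓ := h ^ 2 with hℓ
  have hlog : Real.logb d (ℓ + 1) ≤ h := by
    rw [Real.logb_le_iff_le_rpow hd1 (by positivity), Real.rpow_natCast]
    calc ((ℓ : ℕ) : ℝ) + 1 ≤ 2 ^ h := by rw [hℓ]; push_cast; exact h2
      _ ≤ (d : ℝ) ^ h := by gcongr; exact_mod_cast hd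
  have hlog0 : 0 ≤ Real.logb d (ℓ + 1) := Real.logb_nonneg hd1 (by simp)
  let V := Σ r : Fin (ℓ + 1), (Fin r → A)
  let W : V → ℝ := fun v => ∑ i, -Real.logb d (g (v.2 i))
  have hW : ∀ v, 0 ≤ W v := fun v => Finset.sum_nonneg fun i _ => ht _
  let L : V → ℕ := fun v => ⌈W v + Real.logb d (ℓ + 1)⌉₊
  have hLlt : ∀ v, (L v : ℝ) < W v + Real.logb d (ℓ + 1) + 1 := fun v =>
    Nat.ceil_lt_add_one (add_nonneg (hW v) hlog0)
  have hLh : ∀ v, L v < d ^ h := by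
    intro v
    have hWC : W v ≤ ℓ * C := by
      calc W v ≤ ∑ i : Fin v.1, (C : ℝ) := Finset.sum_le_sum fun i _ => hC _
        _ = v.1 * C := by simp
        _ ≤ ℓ * C := by gcongr; exact_mod_cast Nat.lt_succ_iff.mp v.1.2
    have : (L v : ℝ) < (d : ℝ) ^ h := by
      calc (L v : ℝ) < ℓ * C + h + 1 := by linarith [hLlt v]
        _ ≤ 2 ^ h := by rw [hℓ]; push_cast; linarith
        _ ≤ (d : ℝ) ^ h := by gcongr; exact_mod_cast hd
    exact_mod_cast this
  have hcount := card_le_of_kraft (V := V) (d := d) (by omega)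
    (fun v => (∏ i, g (v.2 i)) / (ℓ + 1))
    (fun v => div_nonneg (Finset.prod_nonneg fun i _ => (hg _).le) (by positivity))
    (by
      rw [← Finset.sum_div, Fintype.sum_sigma, div_le_one (by positivity)]
      have : ∀ r : Fin (ℓ + 1), ∑ p : Fin r → A, ∏ i, g (p i) = 1 := fun r => by
        rw [← Fintype.sum_pow, hsum, one_pow]
      simp [this])
    L
    (by
      intro v
      have hd0 : (0 : ℝ) < d := by linarith
      have hp : 0 < ∏ i, g (v.2 i) := Finset.prod_pos fun i _ => hg _
      rw [← Real.rpow_natCast, ← Real.rpow_neg hd0.le, ← Real.le_logb_iff_rpow_le hd1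
        (by positivity), Real.logb_div hp.ne' (by positivity), Real.logb_prod _ _
        (fun i _ => (hg _).ne')]
      have := Nat.le_ceil (W v + Real.logb d (ℓ + 1))
      have hWe : W v = -∑ i, Real.logb d (g (v.2 i)) := by simp [W]
      change W v + Real.logb d (ℓ + 1) ≤ (L v : ℝ) at this
      linarith)
  obtain ⟨c, hc, hc'⟩ := exists_prefixFree_code L h hcount hLh
  let toV : (l : List A) → l.length ≤ ℓ → V := fun l hl => ⟨⟨l.length, by omega⟩, l.get⟩
  refine ⟨ℓ, h + Real.logb d (ℓ + 1) + 1, fun l => if hl : l.length ≤ ℓ then c (toV l hl) else [],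
    Nat.one_le_pow _ _ h1, by positivity, ?_, ?_, ?_⟩
  · rw [hℓ] at hlog ⊢
    push_cast at hlog ⊢
    linarith
  · intro l hl
    simp only [hl, dif_pos, hc]
    refine ⟨by omega, ?_⟩
    have hs : W (toV l hl) = (l.map fun a => -Real.logb d (g a)).sum := by
      conv_rhs => rw [← List.ofFn_get l, List.map_ofFn, List.sum_ofFn]
      rfl
    rw [← hs]
    push_cast
    linarith [hLlt (toV l hl)]
  · intro l l' hl hl' hp
    simp only [hl, hl', dif_pos] at hp
    have e := congrArg (fun v : V => List.ofFn v.2) (hc' _ _ hp)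
    simpa [toV] using e

/-! ### Runs of two-tape automata -/

theorem pref_length (x : ℕ → A) (n : ℕ) : (pref x n).length = n := by simp [pref]

theorem pref_succ (x : ℕ → A) (n : ℕ) : pref x (n + 1) = pref x n ++ [x n] := by
  simp [pref, List.range_succ]

theorem in1_succ (γ : ℕ → Q × (Option A × Option B) × Q) (n : ℕ) :
    in1 γ (n + 1) = in1 γ n ++ (γ n).2.1.1.toList := by
  cases h : (γ n).2.1.1 <;> simp [in1, List.range_succ, List.reduceOption_append, h]

theorem in2_succ (γ : ℕ → Q × (Option A × Option B) × Q) (n : ℕ) :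
    in2 γ (n + 1) = in2 γ n ++ (γ n).2.1.2.toList := by
  cases h : (γ n).2.1.2 <;> simp [in2, List.range_succ, List.reduceOption_append, h]

theorem in2_congr {γ γ' : ℕ → Q × (Option A × Option B) × Q} {n : ℕ}
    (h : ∀ i < n, γ i = γ' i) : in2 γ n = in2 γ' n := by
  unfold in2
  congr 1
  exact List.map_congr_left fun i hi => by rw [h i (List.mem_range.mp hi)]

/-- The next symbol read on the second tape is the next symbol of `y`. -/
theorem eq_of_in2_eq_pref {γ : ℕ → Q × (Option A × Option B) × Q} {y : ℕ → B}
    (h : ∀ n, in2 γ n = pref y (in2 γ n).length) {n : ℕ} {b : B} (hb : (γ n).2.1.2 = some b) :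
    b = y (in2 γ n).length := by
  have h1 := h (n + 1)
  rw [in2_succ, hb] at h1
  simp only [Option.toList_some, List.length_append, List.length_singleton, pref_succ] at h1
  simpa using (List.append_inj' h1 rfl).2

/-! ### Block compression along a run

The symbols read on the first tape are stored in a buffer together with a flag telling whether they
were read at a marked configuration (a state together with the symbol read on the second tape).
The buffer is encoded and emptied as soon as it holds `ℓ` symbols. -/

section Blocks

variable (sp : Q → Option B → Bool) (ℓ : ℕ) (enc : List (A × Bool) → List D)

/-- The buffer after a transition, before it is possibly emptied. -/
def pushed (s : List (A × Bool)) (τ : Q × (Option A × Option B) × Q) : List (A × Bool) :=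
  s ++ τ.2.1.1.toList.map fun a => (a, sp τ.1 τ.2.1.2)

/-- Empty a full buffer. -/
def nextBuf (s : List (A × Bool)) : List (A × Bool) := if s.length < ℓ then s else []

/-- Encode a full buffer. -/
def emit (s : List (A × Bool)) : List D := if s.length < ℓ then [] else enc s

/-- The buffer before the `n`-th transition of `γ`. -/
def buf (γ : ℕ → Q × (Option A × Option B) × Q) : ℕ → List (A × Bool)
  | 0 => []
  | n + 1 => nextBuf ℓ (pushed sp (buf γ n) (γ n))

/-- The word output during the first `n` transitions of `γ`. -/
def outw (γ : ℕ → Q × (Option A × Option B) × Q) (n : ℕ) : List D :=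
  ((List.range n).map fun i => emit ℓ enc (pushed sp (buf sp ℓ γ i) (γ i))).flatten

variable {sp ℓ enc} {γ γ' : ℕ → Q × (Option A × Option B) × Q}

theorem nextBuf_length_lt (hℓ : 1 ≤ ℓ) (s : List (A × Bool)) : (nextBuf ℓ s).length < ℓ := by
  unfold nextBuf
  split_ifs with h
  · exact h
  · simpa using Nat.lt_of_lt_of_le Nat.zero_lt_one hℓ

theorem buf_length_lt (hℓ : 1 ≤ ℓ) (n : ℕ) : (buf sp ℓ γ n).length < ℓ := by
  cases n with
  | zero => simpa [buf] using Nat.lt_of_lt_of_le Nat.zero_lt_one hℓ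
  | succ n => exact nextBuf_length_lt hℓ _

theorem pushed_length_le {s : List (A × Bool)} (hs : s.length < ℓ)
    (τ : Q × (Option A × Option B) × Q) : (pushed sp s τ).length ≤ ℓ := by
  cases h : τ.2.1.1 <;> simp [pushed, h] <;> omega

theorem outw_succ (n : ℕ) :
    outw sp ℓ enc γ (n + 1) = outw sp ℓ enc γ n ++ emit ℓ enc (pushed sp (buf sp ℓ γ n) (γ n)) := by
  simp [outw, List.range_succ]

theorem outw_prefix_outw {m n : ℕ} (h : m ≤ n) : outw sp ℓ enc γ m <+: outw sp ℓ enc γ n := by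
  induction n, h using Nat.le_induction with
  | base => exact List.prefix_rfl
  | succ n _ ih => exact ih.trans (by rw [outw_succ]; exact List.prefix_append _ _)

theorem buf_congr {n : ℕ} (h : ∀ i < n, γ i = γ' i) : buf sp ℓ γ n = buf sp ℓ γ' n := by
  induction n with
  | zero => rfl
  | succ n ih => simp only [buf]; rw [ih fun i hi => h i (by omega), h n (by omega)]

theorem outw_congr {n : ℕ} (h : ∀ i < n, γ i = γ' i) :
    outw sp ℓ enc γ n = outw sp ℓ enc γ' n := by
  induction n with
  | zero => rfl
  | succ n ih =>
    rw [outw_succ, outw_succ, ih fun i hi => h i (by omega), h n (by omega),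
      buf_congr fun i hi => h i (by omega)]

/-- The current buffer is eventually completed to a full block, whose code is what is output next. -/
theorem exists_block (hℓ : 1 ≤ ℓ) (h1 : Tendsto (fun n => (in1 γ n).length) atTop atTop) (n : ℕ) :
    ∃ m F, F.length = ℓ ∧ pushed sp (buf sp ℓ γ n) (γ n) <+: F ∧
      outw sp ℓ enc γ m = outw sp ℓ enc γ n ++ enc F := by
  by_contra! hcon
  have key : ∀ i, outw sp ℓ enc γ (n + i) = outw sp ℓ enc γ n ∧
      pushed sp (buf sp ℓ γ n) (γ n) <+: pushed sp (buf sp ℓ γ (n + i)) (γ (n + i)) ∧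
      (pushed sp (buf sp ℓ γ (n + i)) (γ (n + i))).length + (in1 γ n).length =
        (buf sp ℓ γ n).length + (in1 γ (n + i + 1)).length ∧
      (pushed sp (buf sp ℓ γ (n + i)) (γ (n + i))).length < ℓ := by
    have small : ∀ i, outw sp ℓ enc γ (n + i) = outw sp ℓ enc γ n →
        pushed sp (buf sp ℓ γ n) (γ n) <+: pushed sp (buf sp ℓ γ (n + i)) (γ (n + i)) →
        (pushed sp (buf sp ℓ γ (n + i)) (γ (n + i))).length < ℓ := by
      intro i ho hp
      by_contra hlt
      refine hcon (n + i + 1) _ ?_ hp ?_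
      · exact le_antisymm (pushed_length_le (buf_length_lt hℓ _) _) (not_lt.mp hlt)
      · rw [outw_succ, ho, emit, if_neg hlt]
    intro i
    induction i with
    | zero =>
      refine ⟨rfl, List.prefix_rfl, ?_, small 0 rfl List.prefix_rfl⟩
      simp [pushed, in1_succ]
      omega
    | succ i ih =>
      obtain ⟨ho, hp, hl, hs⟩ := ih
      have hb : buf sp ℓ γ (n + (i + 1)) = pushed sp (buf sp ℓ γ (n + i)) (γ (n + i)) := by
        rw [← add_assoc, buf, nextBuf, if_pos hs]
      have ho' : outw sp ℓ enc γ (n + (i + 1)) = outw sp ℓ enc γ n := by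
        rw [← add_assoc, outw_succ, ho, emit, if_pos hs, List.append_nil]
      have hp' : pushed sp (buf sp ℓ γ n) (γ n) <+:
          pushed sp (buf sp ℓ γ (n + (i + 1))) (γ (n + (i + 1))) := by
        refine hp.trans ?_
        rw [hb]
        exact List.prefix_append _ _
      refine ⟨ho', hp', ?_, small _ ho' hp'⟩
      rw [in1_succ γ (n + (i + 1)), ← add_assoc n i 1, pushed, List.length_append, add_assoc n i 1,
        hb, List.length_append]
      simp only [List.length_map, add_assoc] at hl ⊢
      omega
  obtain ⟨N, hN⟩ := ((h1.eventually_ge_atTop ((in1 γ n).length + ℓ)).and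
    (eventually_ge_atTop (n + 1))).exists
  have hk := key (N - n - 1)
  rw [show n + (N - n - 1) + 1 = N by omega] at hk
  omega

theorem outw_length_tendsto (hℓ : 1 ≤ ℓ) (h1 : Tendsto (fun n => (in1 γ n).length) atTop atTop)
    (henc : ∀ F, F.length = ℓ → 1 ≤ (enc F).length) :
    Tendsto (fun n => (outw sp ℓ enc γ n).length) atTop atTop := by
  apply tendsto_atTop_atTop_of_monotone (fun m n h => (outw_prefix_outw h).length_le)
  intro N
  induction N with
  | zero => exact ⟨0, Nat.zero_le _⟩
  | succ N ih =>
    obtain ⟨n, hn⟩ := ih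
    obtain ⟨m, F, hF, -, hm⟩ := exists_block (sp := sp) (enc := enc) hℓ h1 n
    refine ⟨m, ?_⟩
    rw [hm, List.length_append]
    have := henc F hF
    omega

end Blocks

/-- The marked symbols of a block. -/
def marked (F : List (A × Bool)) : List A := F.filterMap fun z => if z.2 then some z.1 else none

/-- The unmarked symbols of a block. -/
def unmarked (F : List (A × Bool)) : List A := F.filterMap fun z => if z.2 then none else some z.1

theorem marked_length_add (F : List (A × Bool)) :
    (marked F).length + (unmarked F).length = F.length := by
  induction F with
  | nil => rfl
  | cons z F ih =>
    obtain ⟨a, b⟩ := z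
    cases b <;> simp [marked, unmarked] at ih ⊢ <;> omega

/-- Encode the marked symbols of a block with `code`, and copy the unmarked ones. -/
def encBlock (code : List A → List D) (ι : A → D) (F : List (A × Bool)) : List D :=
  code (marked F) ++ (unmarked F).map ι

theorem encBlock_decode {code : List A → List D} {ι : A → D} (hι : Function.Injective ι) {ℓ : ℕ}
    (hcode : ∀ l l' : List A, l.length ≤ ℓ → l'.length ≤ ℓ → code l <+: code l' → l = l')
    {F F' : List (A × Bool)} (hF : F.length = ℓ) (hF' : F'.length = ℓ) {Z : List D}
    (hZ : encBlock code ι F <+: Z) (hZ' : encBlock code ι F' <+: Z) :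
    marked F = marked F' ∧ unmarked F = unmarked F' := by
  have hl := marked_length_add F
  have hl' := marked_length_add F'
  have h1 : code (marked F) <+: Z := (List.prefix_append _ _).trans hZ
  have h2 : code (marked F') <+: Z := (List.prefix_append _ _).trans hZ'
  have hm : marked F = marked F' := by
    rcases List.prefix_or_prefix_of_prefix h1 h2 with h | h
    · exact hcode _ _ (by omega) (by omega) h
    · exact (hcode _ _ (by omega) (by omega) h).symm
  refine ⟨hm, ?_⟩
  have he : encBlock code ι F = encBlock code ι F' := by
    have hlen : (encBlock code ι F).length = (encBlock code ι F').length := by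
      simp only [encBlock, List.length_append, List.length_map, hm]
      rw [hm] at hl
      omega
    exact (List.prefix_of_prefix_length_le hZ hZ' hlen.le).eq_of_length hlen
  rw [encBlock, encBlock, hm] at he
  exact List.map_injective_iff.mpr hι (List.append_cancel_left he)

/-- Two runs of a `2`-deterministic automaton from the same state with the same second input and
the same block-compressed output are equal. -/
theorem run_eq_of_outw {M : TwoAut A B Q} (hdet : M.TwoDet) {sp : Q → Option B → Bool} {ℓ : ℕ}
    (hℓ : 1 ≤ ℓ) {code : List A → List D} {ι : A → D} (hι : Function.Injective ι)
    (hcode : ∀ l l' : List A, l.length ≤ ℓ → l'.length ≤ ℓ → code l <+: code l' → l = l')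
    {x x' : ℕ → A} {y : ℕ → B} {γ γ' : ℕ → Q × (Option A × Option B) × Q}
    (h0 : (γ 0).1 = (γ' 0).1) (hγ : M.IsRunOn γ x y) (hγ' : M.IsRunOn γ' x' y)
    (hout : ∀ n, ∃ m, outw sp ℓ (encBlock code ι) γ n <+: outw sp ℓ (encBlock code ι) γ' m) :
    γ = γ' := by
  obtain ⟨ht, hc, -, hy, hx, -⟩ := hγ
  obtain ⟨ht', hc', -, hy', hx', -⟩ := hγ'
  suffices H : ∀ n, ∀ i < n, γ i = γ' i from funext fun n => H (n + 1) n (by omega)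
  intro n
  induction n with
  | zero => intro i hi; omega
  | succ n ih =>
    intro i hi
    rcases Nat.lt_succ_iff_lt_or_eq.mp hi with hi | rfl
    · exact ih i hi
    have hst : (γ i).1 = (γ' i).1 := by
      cases i with
      | zero => exact h0
      | succ i => rw [← hc, ← hc', ih i (by omega)]
    obtain ⟨hsupp, hlab⟩ := hdet.2 _ (ht i) _ (ht' i) hst
    simp only [lsupp, Prod.mk.injEq] at hsupp
    have hsnd : (γ i).2.1.2 = (γ' i).2.1.2 := by
      cases hb : (γ i).2.1.2 with
      | none =>
        have := hsupp.2
        rw [hb] at this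
        cases hb' : (γ' i).2.1.2 <;> simp_all
      | some b =>
        have := hsupp.2
        rw [hb] at this
        cases hb' : (γ' i).2.1.2 with
        | none => simp [hb'] at this
        | some b' =>
          rw [eq_of_in2_eq_pref hy hb, eq_of_in2_eq_pref hy' hb', in2_congr ih]
    have hfst : (γ i).2.1.1 = (γ' i).2.1.1 := by
      cases ha : (γ i).2.1.1 with
      | none =>
        have := hsupp.1
        rw [ha] at this
        cases ha' : (γ' i).2.1.1 <;> simp_all
      | some a =>
        have := hsupp.1
        rw [ha] at this
        cases ha' : (γ' i).2.1.1 with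
        | none => simp [ha'] at this
        | some a' =>
          obtain ⟨m, F, hF, hp, hm⟩ := exists_block (sp := sp) (enc := encBlock code ι) hℓ hx i
          obtain ⟨m', F', hF', hp', hm'⟩ := exists_block (sp := sp) (enc := encBlock code ι) hℓ hx' i
          obtain ⟨r, hr⟩ := hout m
          have hZ := hr.trans (outw_prefix_outw (le_max_left r m'))
          have hZ' : outw sp ℓ (encBlock code ι) γ' m' <+: _ :=
            outw_prefix_outw (le_max_right r m')
          obtain ⟨Z, hZe⟩ := (List.prefix_append _ _).trans (hm' ▸ hZ')
          rw [hm, outw_congr ih, ← hZe, List.prefix_append_right_inj] at hZ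
          rw [hm', ← hZe, List.prefix_append_right_inj] at hZ'
          obtain ⟨e1, e2⟩ := encBlock_decode hι hcode hF hF' hZ hZ'
          have comp : ∀ (f : A × Bool → Option A), F.filterMap f = F'.filterMap f →
              f (a, sp (γ i).1 (γ i).2.1.2) = some a → f (a', sp (γ i).1 (γ i).2.1.2) = some a' →
              a = a' := by
            intro f hf h1 h2
            have q := hp.filterMap f
            have q' := hp'.filterMap f
            rw [← hf, ← buf_congr ih] at q'
            simp only [pushed, ha, ha', ← hst, ← hsnd, Option.toList_some, List.map_cons,
              List.map_nil, List.filterMap_append, List.filterMap_cons, List.filterMap_nil,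
              h1, h2] at q q'
            have := (List.prefix_of_prefix_length_le q q' (by simp)).eq_of_length (by simp)
            simpa using List.append_cancel_left this
          congr 1
          cases hsp : sp (γ i).1 (γ i).2.1.2 with
          | true => exact comp _ e1 (by simp [hsp]) (by simp [hsp])
          | false => exact comp _ e2 (by simp [hsp]) (by simp [hsp])
    exact hlab (Prod.ext hfst hsnd)

/-- Length bound for the block-compressed output in terms of the weights of the symbols read:
each block costs an overhead `H`. -/
theorem outw_length_le {sp : Q → Option B → Bool} {ℓ : ℕ} (hℓ : 1 ≤ ℓ)
    {enc : List (A × Bool) → List D} {H : ℝ} (hH : 0 ≤ H) (w : A × Bool → ℝ) (hw : ∀ z, 0 ≤ w z)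
    (henc : ∀ F, F.length = ℓ → ((enc F).length : ℝ) ≤ H + (F.map w).sum)
    (γ : ℕ → Q × (Option A × Option B) × Q) (n : ℕ) :
    ((outw sp ℓ enc γ n).length : ℝ) ≤
      ∑ i ∈ Finset.range n, ((pushed sp [] (γ i)).map w).sum + H / ℓ * (in1 γ n).length := by
  have hℓ0 : (0 : ℝ) < ℓ := by exact_mod_cast hℓ
  have key : ((outw sp ℓ enc γ n).length : ℝ) + ((buf sp ℓ γ n).map w).sum +
      H / ℓ * (buf sp ℓ γ n).length ≤
      ∑ i ∈ Finset.range n, ((pushed sp [] (γ i)).map w).sum + H / ℓ * (in1 γ n).length := by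
    induction n with
    | zero => simp [outw, buf, in1]
    | succ n ih =>
      have h1 : ((pushed sp (buf sp ℓ γ n) (γ n)).map w).sum =
          ((buf sp ℓ γ n).map w).sum + ((pushed sp [] (γ n)).map w).sum := by
        simp [pushed]
      have h2 : ((in1 γ (n + 1)).length : ℝ) + (buf sp ℓ γ n).length =
          (in1 γ n).length + (pushed sp (buf sp ℓ γ n) (γ n)).length := by
        simp [in1_succ, pushed]
        ring
      have h3 : H / ℓ * (in1 γ (n + 1)).length + H / ℓ * (buf sp ℓ γ n).length =
          H / ℓ * (in1 γ n).length + H / ℓ * (pushed sp (buf sp ℓ γ n) (γ n)).length := by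
        rw [← mul_add, h2, mul_add]
      rw [outw_succ, buf, Finset.sum_range_succ, List.length_append]
      by_cases hlt : (pushed sp (buf sp ℓ γ n) (γ n)).length < ℓ
      · rw [emit, if_pos hlt, nextBuf, if_pos hlt]
        push_cast [List.length_nil]
        linarith
      · have hle := le_antisymm (pushed_length_le (buf_length_lt hℓ n) (γ n)) (not_lt.mp hlt)
        rw [emit, if_neg hlt, nextBuf, if_neg hlt]
        have h4 := henc _ hle
        rw [hle, div_mul_cancel₀ _ hℓ0.ne'] at h3
        push_cast [List.map_nil, List.sum_nil, List.length_nil]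
        linarith
  have h1 : 0 ≤ ((buf sp ℓ γ n).map w).sum :=
    List.sum_nonneg fun r hr => by
      obtain ⟨z, -, rfl⟩ := List.mem_map.mp hr
      exact hw z
  have h2 : 0 ≤ H / ℓ * (buf sp ℓ γ n).length := by positivity
  linarith

theorem eq_of_pref_eq {x x' : ℕ → A} {u : ℕ → ℕ} (hu : Tendsto u atTop atTop)
    (h : ∀ n, pref x (u n) = pref x' (u n)) : x = x' := by
  funext i
  obtain ⟨n, hn⟩ := (hu.eventually_gt_atTop i).exists
  have := h n
  simp only [pref, List.map_inj_left, List.mem_range] at this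
  exact this i hn

/-! ### The compressor attached to a block code -/

section Compressor

variable (M : TwoAut A B Q) (q₀ : Q) (sp : Q → Option B → Bool) (ℓ : ℕ)
  (enc : List (A × Bool) → List D) {S : Type*} (e : Q × List (A × Bool) → S)

/-- The compressor which simulates `M` and encodes the symbols of the first tape by blocks of
length `ℓ`. Its states are the pairs of a state of `M` and a buffer, numbered by `e`. -/
def blockComp : Comp3 A B D S where
  init := e (q₀, [])
  trans := {t | ∃ τ ∈ M.trans, ∃ s : List (A × Bool), s.length < ℓ ∧
    t = (e (τ.1, s), τ.2.1, emit ℓ enc (pushed sp s τ), e (τ.2.2, nextBuf ℓ (pushed sp s τ)))}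

variable {M q₀ sp ℓ enc e}

theorem blockComp_twoDet (hdet : M.TwoDet) (he : Set.InjOn e {z | z.2.length < ℓ}) :
    (blockComp M q₀ sp ℓ enc e).TwoDet := by
  rintro _ ⟨τ, hτ, s, hs, rfl⟩ _ ⟨τ', hτ', s', hs', rfl⟩ heq
  have h := he (show (τ.1, s).2.length < ℓ from hs) (show (τ'.1, s').2.length < ℓ from hs') heq
  simp only [Prod.mk.injEq] at h
  obtain ⟨h1, rfl⟩ := h
  obtain ⟨h2, h3⟩ := hdet.2 τ hτ τ' hτ' h1
  refine ⟨h2, fun h => ?_⟩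
  rw [h3 h]

theorem exists_run_of_blockComp (hℓ : 1 ≤ ℓ) (he : Set.InjOn e {z | z.2.length < ℓ})
    {x : ℕ → A} {y : ℕ → B} {δ : ℕ → S × (Option A × Option B) × List D × S}
    (hδ : (blockComp M q₀ sp ℓ enc e).IsAccRunOn δ x y) :
    ∃ γ, (γ 0).1 = q₀ ∧ M.IsRunOn γ x y ∧ ∀ n, c3out δ n = outw sp ℓ enc γ n := by
  obtain ⟨h0, ht, hc, hx, hy, hx', hy', -⟩ := hδ
  choose γ hγ s hs heq using ht
  have h1 : c3in1 δ = in1 γ := by funext n; simp [c3in1, in1, heq]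
  have h2 : c3in2 δ = in2 γ := by funext n; simp [c3in2, in2, heq]
  have hcont : ∀ n, (γ n).2.2 = (γ (n + 1)).1 ∧
      nextBuf ℓ (pushed sp (s n) (γ n)) = s (n + 1) := by
    intro n
    have := hc n
    rw [heq n, heq (n + 1)] at this
    simpa using he (nextBuf_length_lt hℓ _) (hs (n + 1)) this
  have hstart : (γ 0).1 = q₀ ∧ s 0 = [] := by
    rw [heq 0] at h0
    simpa using he (hs 0) (show ([] : List (A × Bool)).length < ℓ from hℓ) h0
  have hbuf : ∀ n, s n = buf sp ℓ γ n := by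
    intro n
    induction n with
    | zero => exact hstart.2
    | succ n ih => rw [← (hcont n).2, ih, buf]
  refine ⟨γ, hstart.1, ⟨hγ, fun n => (hcont n).1, ?_, ?_, ?_, ?_⟩, ?_⟩
  · rwa [← h1]
  · rwa [← h2]
  · rwa [← h1]
  · rwa [← h2]
  · intro n
    simp [c3out, outw, heq, hbuf]

theorem blockComp_oneToOne (hdet : M.TwoDet) (hℓ : 1 ≤ ℓ)
    (he : Set.InjOn e {z | z.2.length < ℓ}) {code : List A → List D} {ι : A → D}
    (hι : Function.Injective ι)
    (hcode : ∀ l l' : List A, l.length ≤ ℓ → l'.length ≤ ℓ → code l <+: code l' → l = l') :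
    (blockComp M q₀ sp ℓ (encBlock code ι) e).OneToOne := by
  intro x x' y δ δ' hδ hδ' hout _
  obtain ⟨γ, h0, hγ, ho⟩ := exists_run_of_blockComp hℓ he hδ
  obtain ⟨γ', h0', hγ', ho'⟩ := exists_run_of_blockComp hℓ he hδ'
  have : γ = γ' := run_eq_of_outw hdet hℓ hι hcode (h0.trans h0'.symm) hγ hγ' fun n => by
    obtain ⟨m, hm⟩ := hout n
    exact ⟨m, by rwa [← ho, ← ho']⟩
  subst this
  exact eq_of_pref_eq hγ.2.2.2.2.1 fun n => by rw [← hγ.2.2.1 n, ← hγ'.2.2.1 n]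

theorem exists_blockComp_run (hℓ : 1 ≤ ℓ) {x : ℕ → A} {y : ℕ → B}
    {γ : ℕ → Q × (Option A × Option B) × Q} (hγ : M.IsRunOn γ x y)
    (henc : ∀ F, F.length = ℓ → 1 ≤ (enc F).length) :
    ∃ δ, (blockComp M (γ 0).1 sp ℓ enc e).IsAccRunOn δ x y ∧
      c3in1 δ = in1 γ ∧ c3out δ = outw sp ℓ enc γ := by
  have hlen := outw_length_tendsto (sp := sp) hℓ hγ.2.2.2.2.1 henc
  obtain ⟨ht, hc, hx, hy, hx', hy'⟩ := hγ
  let δ : ℕ → S × (Option A × Option B) × List D × S := fun n =>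
    (e ((γ n).1, buf sp ℓ γ n), (γ n).2.1, emit ℓ enc (pushed sp (buf sp ℓ γ n) (γ n)),
      e ((γ n).2.2, buf sp ℓ γ (n + 1)))
  have h1 : c3in1 δ = in1 γ := rfl
  have h2 : c3in2 δ = in2 γ := rfl
  have h3 : c3out δ = outw sp ℓ enc γ := rfl
  refine ⟨δ, ⟨rfl, fun n => ⟨γ n, ht n, buf sp ℓ γ n, buf_length_lt hℓ n, rfl⟩, fun n => ?_,
    ?_, ?_, ?_, ?_, ?_⟩, h1, h3⟩
  · simp only [δ, hc n]
  · rwa [h1]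
  · rwa [h2]
  · rwa [h1]
  · rwa [h2]
  · rwa [h3]

end Compressor

theorem liminf_nonneg {u : ℕ → ℝ} (hu : ∀ n, 0 ≤ u n) : 0 ≤ liminf u atTop := by
  rw [liminf_eq]
  exact Real.sSup_nonneg' ⟨0, Eventually.of_forall hu, le_rfl⟩

theorem condRho_le [Fintype A] [Fintype B] [Fintype Q] {x : ℕ → A} {y : ℕ → B}
    {M : TwoAut A B Q} (hdet : M.TwoDet) {γ : ℕ → Q × (Option A × Option B) × Q}
    (hγ : M.IsRunOn γ x y) (sp : Q → Option B → Bool) {ℓ : ℕ} (hℓ : 1 ≤ ℓ) {d : ℕ} (hd : 2 ≤ d)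
    {code : List A → List (Fin d)} {ι : A → Fin d} (hι : Function.Injective ι)
    (hcode : ∀ l l' : List A, l.length ≤ ℓ → l'.length ≤ ℓ → code l <+: code l' → l = l')
    (hne : ∀ l : List A, l.length ≤ ℓ → 1 ≤ (code l).length) :
    condRho x y ≤ liminf (fun n : ℕ =>
        (((outw sp ℓ (encBlock code ι) γ n).length : ℝ) * Real.log d) /
        (((in1 γ n).length : ℝ) * Real.log (Fintype.card A))) atTop := by
  classical
  obtain ⟨m, e, he⟩ : ∃ (m : ℕ) (e : Q × List (A × Bool) → Fin m),
      Set.InjOn e {z | z.2.length < ℓ} := by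
    have hfin : {z : Q × List (A × Bool) | z.2.length < ℓ}.Finite := by
      have := (Set.finite_univ (α := Q)).prod (List.finite_length_lt (A × Bool) ℓ)
      exact this.subset fun z hz => ⟨Set.mem_univ _, hz⟩
    have := hfin.fintype
    let f := Fintype.equivFin {z : Q × List (A × Bool) | z.2.length < ℓ}
    refine ⟨_, fun z => if hz : z.2.length < ℓ then (f ⟨z, hz⟩).succ else 0, ?_⟩
    intro z hz z' hz' h
    simp only [Set.mem_ofPred_eq] at hz hz'
    simpa [hz, hz'] using h
  have hblock : ∀ F : List (A × Bool), F.length = ℓ → 1 ≤ (encBlock code ι F).length := by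
    intro F hF
    have := marked_length_add F
    have := hne (marked F) (by omega)
    rw [encBlock, List.length_append]
    omega
  obtain ⟨δ, hδ, hin, hout⟩ := exists_blockComp_run (M := M) (sp := sp) (e := e) hℓ hγ hblock
  apply csInf_le
  · refine ⟨0, ?_⟩
    rintro _ ⟨m, d, hd, C, -, -, δ, -, rfl⟩
    exact liminf_nonneg fun n => by
      have := Real.log_natCast_nonneg d
      have := Real.log_natCast_nonneg (Fintype.card A)
      positivity
  · exact ⟨m, d, hd, _, blockComp_twoDet hdet he, blockComp_oneToOne hdet hℓ he hι hcode, δ, hδ,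
      by rw [hin, hout]⟩

/-! ### Absence of bias -/

/-- Number of the first `n` terms of `γ` satisfying `P`. -/
noncomputable def cnt {S : Type*} (P : S → Prop) (γ : ℕ → S) (n : ℕ) : ℕ :=
  Nat.card {i : ℕ | i < n ∧ P (γ i)}

section cnt

variable {S : Type*} {P P' : S → Prop} {γ : ℕ → S}

open Classical in
theorem cnt_eq_sum (P : S → Prop) (γ : ℕ → S) (n : ℕ) :
    cnt P γ n = ∑ i ∈ Finset.range n, if P (γ i) then 1 else 0 := by
  rw [Finset.sum_boole, Nat.cast_id]
  exact Nat.subtype_card _ fun i => by simp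

open Classical in
theorem cnt_succ (P : S → Prop) (γ : ℕ → S) (n : ℕ) :
    (cnt P γ (n + 1) : ℝ) = cnt P γ n + if P (γ n) then 1 else 0 := by
  rw [cnt_eq_sum, cnt_eq_sum, Finset.sum_range_succ]
  push_cast
  rfl

theorem cnt_congr (h : ∀ i, P (γ i) ↔ P' (γ i)) (n : ℕ) : cnt P γ n = cnt P' γ n := by
  simp only [cnt, h]

end cnt

theorem log_one_add_ge {z : ℝ} (hz : |z| ≤ 1 / 2) : z - 2 * z ^ 2 ≤ Real.log (1 + z) := by
  obtain ⟨h1, h2⟩ := abs_le.mp hz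
  have hpos : 0 < 1 + z := by linarith
  refine le_trans ?_ (Real.one_sub_inv_le_log_of_pos hpos)
  rw [← sub_nonneg]
  have : 1 - (1 + z)⁻¹ - (z - 2 * z ^ 2) = z ^ 2 * (1 + 2 * z) / (1 + z) := by
    field_simp
    ring
  rw [this]
  have : 0 ≤ 1 + 2 * z := by linarith
  positivity

/-- The weight of the symbols read along a run, when the marked symbols are weighted according to
the distribution giving to `a₀` the probability `(1 + δ * (card A - 1)) / card A`. -/
theorem sum_pushed_le [Fintype A] [DecidableEq A] (a₀ : A) (hA : 2 ≤ Fintype.card A)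
    (sp : Q → Option B → Bool) {δ : ℝ} (hδ : |δ| * Fintype.card A ≤ 1 / 2)
    (γ : ℕ → Q × (Option A × Option B) × Q) (n : ℕ) :
    ∑ i ∈ Finset.range n, ((pushed sp [] (γ i)).map fun z : A × Bool => if z.2 then
        -Real.logb (Fintype.card A)
          ((1 + δ * ((if z.1 = a₀ then (Fintype.card A : ℝ) else 0) - 1)) / Fintype.card A)
        else 1).sum ≤
      (in1 γ n).length -
        (δ * (Fintype.card A * cnt (fun τ => τ.2.1.1 = some a₀ ∧ sp τ.1 τ.2.1.2 = true) γ n -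
            cnt (fun τ => τ.2.1.1.isSome ∧ sp τ.1 τ.2.1.2 = true) γ n) -
          2 * (δ * Fintype.card A) ^ 2 *
            cnt (fun τ => τ.2.1.1.isSome ∧ sp τ.1 τ.2.1.2 = true) γ n) /
          Real.log (Fintype.card A) := by
  have hN : (2 : ℝ) ≤ Fintype.card A := by exact_mod_cast hA
  set N : ℝ := (Fintype.card A : ℝ)
  have hlog : 0 < Real.log N := Real.log_pos (by linarith)
  have key : ∀ a : A, -Real.logb N ((1 + δ * ((if a = a₀ then N else 0) - 1)) / N) ≤
      1 - (δ * (N * (if a = a₀ then 1 else 0) - 1) - 2 * (δ * N) ^ 2) / Real.log N := by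
    intro a
    set z := δ * ((if a = a₀ then N else 0) - 1) with hz
    have hz1 : |z| ≤ |δ * N| := by
      rw [hz, abs_mul, abs_mul]
      refine mul_le_mul_of_nonneg_left ?_ (abs_nonneg _)
      rw [abs_of_nonneg (by linarith : 0 ≤ N)]
      split_ifs <;> rw [abs_le] <;> constructor <;> linarith
    have hz2 : |z| ≤ 1 / 2 := hz1.trans (by
      rw [abs_mul, abs_of_nonneg (by linarith : 0 ≤ N)]; exact hδ)
    have hz3 : z ^ 2 ≤ (δ * N) ^ 2 := sq_le_sq.mpr hz1
    have hpos : 0 < 1 + z := by linarith [(abs_le.mp hz2).1]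
    have h1 := log_one_add_ge hz2
    have hz4 : δ * (N * (if a = a₀ then 1 else 0) - 1) = z := by
      rw [hz]; split_ifs <;> simp
    rw [hz4, Real.logb, Real.log_div hpos.ne' (by linarith), sub_div, div_self hlog.ne', neg_sub,
      sub_le_sub_iff_left, div_le_div_iff_of_pos_right hlog]
    linarith
  induction n with
  | zero => simp [cnt, in1]
  | succ n ih =>
    rw [Finset.sum_range_succ, cnt_succ, cnt_succ, in1_succ, List.length_append]
    rcases γ n with ⟨q, ⟨a, b⟩, q'⟩
    push_cast
    rcases a with _ | a
    · simpa [pushed] using ih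
    · cases hs : sp q b
      · simp [pushed, hs] at ih ⊢
        linarith
      · have := key a
        simp only [pushed, Option.toList_some, List.map_cons, List.map_nil, List.nil_append, hs,
          if_true, List.sum_cons, List.sum_nil, List.length_singleton, Option.isSome_some,
          and_self, and_true, Option.some.injEq, add_zero, Nat.cast_one] at ih ⊢
        refine (add_le_add ih this).trans (le_of_eq ?_)
        split_ifs <;> ring

theorem in1_length_le (γ : ℕ → Q × (Option A × Option B) × Q) (n : ℕ) : (in1 γ n).length ≤ n := by
  induction n with
  | zero => simp [in1]
  | succ n ih =>
    rw [in1_succ, List.length_append]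
    have : (γ n).2.1.1.toList.length ≤ 1 := by cases (γ n).2.1.1 <;> simp
    omega

theorem eventually_bias_lt [Fintype A] [Fintype B] [Fintype Q] {x : ℕ → A} {y : ℕ → B}
    (hρ : 1 ≤ condRho x y) (hA : 2 ≤ Fintype.card A) {M : TwoAut A B Q} (hdet : M.TwoDet)
    {γ : ℕ → Q × (Option A × Option B) × Q} (hγ : M.IsRunOn γ x y)
    (sp : Q → Option B → Bool) (a₀ : A) {k : ℕ → ℕ} (hk : Tendsto k atTop atTop) {c : ℝ}
    (hc : 0 < c)
    (hS : ∀ᶠ n in atTop,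
      c * k n ≤ cnt (fun τ => τ.2.1.1.isSome ∧ sp τ.1 τ.2.1.2 = true) γ (k n))
    {θ η : ℝ} (hθ : |θ| = 1) (hη : 0 < η) (hη1 : η ≤ 1) :
    ∀ᶠ n in atTop,
      θ * (Fintype.card A * cnt (fun τ => τ.2.1.1 = some a₀ ∧ sp τ.1 τ.2.1.2 = true) γ (k n) -
          cnt (fun τ => τ.2.1.1.isSome ∧ sp τ.1 τ.2.1.2 = true) γ (k n)) <
        η * cnt (fun τ => τ.2.1.1.isSome ∧ sp τ.1 τ.2.1.2 = true) γ (k n) := by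
  classical
  by_contra hcon
  rw [not_eventually] at hcon
  have hN : (2 : ℝ) ≤ Fintype.card A := by exact_mod_cast hA
  set N : ℝ := (Fintype.card A : ℝ) with hNdef
  have hN0 : 0 < N := by linarith
  have hlog : 0 < Real.log N := Real.log_pos (by linarith)
  set δ : ℝ := θ * η / (4 * N ^ 2) with hδdef
  have hδabs : |δ| * N = η / (4 * N) := by
    rw [hδdef, abs_div, abs_mul, hθ, abs_of_pos hη, abs_of_pos (by positivity : 0 < 4 * N ^ 2)]
    field_simp
  have hδN : |δ| * N ≤ 1 / 2 := by
    rw [hδabs, div_le_div_iff₀ (by positivity) two_pos]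
    linarith
  have hδsq : (δ * N) ^ 2 = η ^ 2 / (16 * N ^ 2) := by
    rw [← sq_abs, abs_mul, abs_of_pos hN0, hδabs]
    ring
  set κ : ℝ := η ^ 2 / (8 * N ^ 2) / Real.log N with hκ
  have hκ0 : 0 < κ := by positivity
  let g : A → ℝ := fun a => (1 + δ * ((if a = a₀ then N else 0) - 1)) / N
  have hz : ∀ a, |δ * ((if a = a₀ then N else 0) - 1)| ≤ 1 / 2 := by
    intro a
    rw [abs_mul]
    refine (mul_le_mul_of_nonneg_left ?_ (abs_nonneg _)).trans hδN
    split_ifs <;> rw [abs_le] <;> constructor <;> linarith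
  have hg : ∀ a, 0 < g a := fun a =>
    div_pos (by linarith [(abs_le.mp (hz a)).1]) hN0
  have hg1 : ∀ a, g a ≤ 1 := fun a => by
    rw [div_le_one hN0]
    linarith [(abs_le.mp (hz a)).2]
  have hsum : ∑ a, g a = 1 := by
    rw [← Finset.sum_div, Finset.sum_add_distrib, ← Finset.mul_sum, Finset.sum_sub_distrib]
    simp [← hNdef, hN0.ne']
  obtain ⟨ℓ, H, code, hℓ, hH, hHℓ, hlen, hcode⟩ :=
    exists_block_code (Fintype.card A) hA g hg hg1 hsum (κ * c / 2) (by positivity)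
  have hℓ0 : (0 : ℝ) < ℓ := by exact_mod_cast hℓ
  let ι : A → Fin (Fintype.card A) := Fintype.equivFin A
  let w : A × Bool → ℝ := fun z => if z.2 then -Real.logb N (g z.1) else 1
  have hw : ∀ z, 0 ≤ w z := by
    intro z
    simp only [w]
    split_ifs
    · exact neg_nonneg.mpr (Real.logb_nonpos (by linarith) (hg _).le (hg1 _))
    · exact zero_le_one
  have hsplit : ∀ F : List (A × Bool), (F.map w).sum =
      ((marked F).map fun a => -Real.logb N (g a)).sum + (unmarked F).length := by
    intro F
    induction F with
    | nil => simp [marked, unmarked]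
    | cons z F ih =>
      obtain ⟨a, b⟩ := z
      cases b <;> simp [marked, unmarked, w] at ih ⊢ <;> linarith
  have henc : ∀ F, F.length = ℓ → ((encBlock code ι F).length : ℝ) ≤ H + (F.map w).sum := by
    intro F hF
    have h1 := marked_length_add F
    have h2 := (hlen (marked F) (by omega)).2
    rw [hsplit, encBlock, List.length_append, List.length_map]
    push_cast
    linarith
  have hle := condRho_le hdet hγ sp hℓ hA (code := code) (ι := ι) (Fintype.equivFin A).injective
    hcode fun l hl => (hlen l hl).1
  refine absurd (hρ.trans hle) (not_le.mpr ?_)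
  have hpos := (hγ.2.2.2.2.1.comp hk).eventually_gt_atTop 0
  have hfreq := hcon.and_eventually (hS.and hpos)
  have hfreq' : ∃ᶠ m in atTop,
      (((outw sp ℓ (encBlock code ι) γ m).length : ℝ) * Real.log N) /
        (((in1 γ m).length : ℝ) * Real.log N) ≤ 1 - κ * c / 2 := by
    refine hk.frequently (hfreq.mono ?_)
    rintro n ⟨hdev, hSn, hpn⟩
    rw [not_lt] at hdev
    set S : ℝ := ((cnt (fun τ => τ.2.1.1.isSome ∧ sp τ.1 τ.2.1.2 = true) γ (k n) : ℕ) : ℝ)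
    set T : ℝ := ((cnt (fun τ => τ.2.1.1 = some a₀ ∧ sp τ.1 τ.2.1.2 = true) γ (k n) : ℕ) : ℝ)
    have hI : 0 < ((in1 γ (k n)).length : ℝ) := by exact_mod_cast hpn
    have hIk : ((in1 γ (k n)).length : ℝ) ≤ k n := by exact_mod_cast in1_length_le γ (k n)
    have h1 := outw_length_le (sp := sp) hℓ hH w hw henc γ (k n)
    have h2 := sum_pushed_le a₀ hA sp hδN γ (k n)
    have h3 : H / ℓ ≤ κ * c / 2 := by rwa [div_le_iff₀ hℓ0]
    have h4 : κ * S ≤ (δ * (N * T - S) - 2 * (δ * N) ^ 2 * S) / Real.log N := by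
      rw [hκ, div_mul_eq_mul_div, div_le_div_iff_of_pos_right hlog, hδsq]
      have : δ * (N * T - S) = η / (4 * N ^ 2) * (θ * (N * T - S)) := by rw [hδdef]; ring
      rw [this]
      have h5 := mul_le_mul_of_nonneg_left hdev (by positivity : 0 ≤ η / (4 * N ^ 2))
      have h6 : η / (4 * N ^ 2) * (η * S) - 2 * (η ^ 2 / (16 * N ^ 2)) * S =
        η ^ 2 / (8 * N ^ 2) * S := by ring
      linarith
    have h7 : κ * (c * (in1 γ (k n)).length) ≤ κ * S := by
      refine mul_le_mul_of_nonneg_left ?_ hκ0.le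
      exact (mul_le_mul_of_nonneg_left hIk hc.le).trans hSn
    have h8 := mul_le_mul_of_nonneg_right h3 hI.le
    rw [mul_div_mul_right _ _ hlog.ne', div_le_iff₀ hI]
    have h9 := h1.trans (add_le_add_left h2 _)
    linarith
  refine lt_of_le_of_lt (liminf_le_of_frequently_le hfreq' ?_) (by
    have : 0 < κ * c / 2 := by positivity
    linarith)
  exact isBoundedUnder_of ⟨0, fun n => by positivity⟩

theorem tendsto_cnt_div [Fintype A] [Fintype B] [Fintype Q] {x : ℕ → A} {y : ℕ → B}
    (hρ : 1 ≤ condRho x y) (hA : 2 ≤ Fintype.card A) {M : TwoAut A B Q} (hdet : M.TwoDet)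
    {γ : ℕ → Q × (Option A × Option B) × Q} (hγ : M.IsRunOn γ x y)
    (sp : Q → Option B → Bool) (a₀ : A) {k : ℕ → ℕ} (hk : Tendsto k atTop atTop) {c : ℝ}
    (hc : 0 < c)
    (hS : ∀ᶠ n in atTop,
      c * k n ≤ cnt (fun τ => τ.2.1.1.isSome ∧ sp τ.1 τ.2.1.2 = true) γ (k n)) :
    Tendsto (fun n => (cnt (fun τ => τ.2.1.1 = some a₀ ∧ sp τ.1 τ.2.1.2 = true) γ (k n) : ℝ) /
      cnt (fun τ => τ.2.1.1.isSome ∧ sp τ.1 τ.2.1.2 = true) γ (k n)) atTop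
      (𝓝 (Fintype.card A : ℝ)⁻¹) := by
  have hN : (2 : ℝ) ≤ Fintype.card A := by exact_mod_cast hA
  rw [Metric.tendsto_atTop']
  intro ε hε
  have hη : 0 < min ε 1 := lt_min hε one_pos
  have h1 := eventually_bias_lt hρ hA hdet hγ sp a₀ hk hc hS abs_one hη (min_le_right _ _)
  have h2 := eventually_bias_lt hρ hA hdet hγ sp a₀ hk hc hS
    (by simp : |(-1 : ℝ)| = 1) hη (min_le_right _ _)
  have h3 := hk.eventually_gt_atTop 0
  obtain ⟨n₀, hn₀⟩ := eventually_atTop.mp (h1.and (h2.and (h3.and hS)))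
  refine ⟨n₀, fun n hn => ?_⟩
  obtain ⟨h1, h2, h3, h4⟩ := hn₀ n hn.le
  set S : ℝ := ((cnt (fun τ => τ.2.1.1.isSome ∧ sp τ.1 τ.2.1.2 = true) γ (k n) : ℕ) : ℝ)
  set T : ℝ := ((cnt (fun τ => τ.2.1.1 = some a₀ ∧ sp τ.1 τ.2.1.2 = true) γ (k n) : ℕ) : ℝ)
  set N : ℝ := (Fintype.card A : ℝ)
  have hS0 : 0 < S := lt_of_lt_of_le (mul_pos hc (by exact_mod_cast h3)) h4
  have h5 : min ε 1 * S ≤ ε * S := mul_le_mul_of_nonneg_right (min_le_left _ _) hS0.le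
  have hN0 : 0 < N := by linarith
  have h6 : T / S - N⁻¹ = (N * T - S) / (N * S) := by field_simp
  have h7 : ε * S ≤ ε * (N * S) :=
    mul_le_mul_of_nonneg_left (le_mul_of_one_le_left hS0.le (by linarith)) hε.le
  rw [Real.dist_eq, h6, abs_lt, lt_div_iff₀ (by positivity), div_lt_iff₀ (by positivity)]
  constructor <;> linarith

/-! ### Normal words are incompressible -/

/-- The word obtained by concatenating the words `f (γ i)` for `i < n`. -/
def word {S : Type*} (f : S → List D) (γ : ℕ → S) (n : ℕ) : List D :=
  ((List.range n).map fun i => f (γ i)).flatten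

/-- Follow `γ` during `s` steps, and then `δ`. -/
def splice {S : Type*} (γ : ℕ → S) (s : ℕ) (δ : ℕ → S) (i : ℕ) : S :=
  if i < s then γ i else δ (i - s)

section word

variable {S : Type*} {f : S → List D} {γ δ : ℕ → S}

theorem word_succ (n : ℕ) : word f γ (n + 1) = word f γ n ++ f (γ n) := by
  simp [word, List.range_succ]

theorem word_add (m n : ℕ) : word f γ (m + n) = word f γ m ++ word f (fun i => γ (m + i)) n := by
  induction n with
  | zero => simp [word]
  | succ n ih => rw [← add_assoc, word_succ, ih, word_succ, List.append_assoc]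

theorem word_congr {n : ℕ} (h : ∀ i < n, γ i = δ i) : word f γ n = word f δ n := by
  unfold word
  congr 1
  exact List.map_congr_left fun i hi => by rw [h i (List.mem_range.mp hi)]

theorem word_prefix_word {m n : ℕ} (h : m ≤ n) : word f γ m <+: word f γ n := by
  obtain ⟨k, rfl⟩ := Nat.exists_eq_add_of_le h
  rw [word_add]
  exact List.prefix_append _ _

theorem word_splice_of_le {s n : ℕ} (h : n ≤ s) : word f (splice γ s δ) n = word f γ n :=
  word_congr fun i hi => by rw [splice, if_pos (by omega)]

theorem word_splice (s n : ℕ) : word f (splice γ s δ) (s + n) = word f γ s ++ word f δ n := by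
  rw [word_add, word_splice_of_le le_rfl]
  congr 1
  exact word_congr fun i _ => by rw [splice, if_neg (by omega), Nat.add_sub_cancel_left]

/-- Replacing the part of `γ` between `s` and `t` by the part between `s'` and `t'`. -/
theorem word_splice_splice {s s' t t' : ℕ} (h : s' ≤ t') (n : ℕ) {u : List D}
    (hu : word f γ t' = word f γ s' ++ u) :
    word f (splice γ s fun i => splice γ t' (fun j => γ (t + j)) (s' + i)) (s + (t' - s' + n)) =
      word f γ s ++ (u ++ word f (fun j => γ (t + j)) n) := by
  rw [word_splice]
  congr 1
  have h1 := word_splice (f := f) (γ := γ) (δ := fun j => γ (t + j)) t' n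
  rw [show t' + n = s' + (t' - s' + n) by omega, word_add, word_splice_of_le h, hu,
    List.append_assoc] at h1
  exact List.append_cancel_left h1

end word

/-- A sequence of words, each a prefix of the next one, whose lengths are unbounded has a limit. -/
theorem exists_eq_pref {L : ℕ → List A} (hL : ∀ m n, m ≤ n → L m <+: L n)
    (hlen : Tendsto (fun n => (L n).length) atTop atTop) :
    ∃ x : ℕ → A, ∀ n, L n = pref x (L n).length := by
  have h : ∀ i, ∃ n, i < (L n).length := fun i => (hlen.eventually_gt_atTop i).exists
  choose r hr using h
  refine ⟨fun i => (L (r i))[i]'(hr i), fun n => ?_⟩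
  refine List.ext_getElem (by simp [pref]) fun i h1 h2 => ?_
  simp only [pref, List.getElem_map, List.getElem_range]
  rcases le_total n (r i) with h | h
  · exact (hL _ _ h).getElem h1
  · exact ((hL _ _ h).getElem (hr i)).symm

section Comp2

variable {C : Comp2 A D Q} {γ : ℕ → Q × Option A × List D × Q} {x : ℕ → A}

theorem c2in_eq_word (γ : ℕ → Q × Option A × List D × Q) :
    c2in γ = word (fun τ => τ.2.1.toList) γ := by
  funext n
  induction n with
  | zero => rfl
  | succ n ih =>
    rw [word_succ, ← ih]
    cases h : (γ n).2.1 <;> simp [c2in, List.range_succ, List.reduceOption_append, h]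

theorem c2out_eq_word (γ : ℕ → Q × Option A × List D × Q) :
    c2out γ = word (fun τ => τ.2.2.1) γ := rfl

theorem splice_path {γ δ : ℕ → Q × Option A × List D × Q}
    (hγ : ∀ n, γ n ∈ C.trans) (hγ' : ∀ n, (γ n).2.2.2 = (γ (n + 1)).1)
    (hδ : ∀ n, δ n ∈ C.trans) (hδ' : ∀ n, (δ n).2.2.2 = (δ (n + 1)).1) {s : ℕ}
    (h : (γ s).1 = (δ 0).1) :
    (∀ n, splice γ s δ n ∈ C.trans) ∧
      (∀ n, (splice γ s δ n).2.2.2 = (splice γ s δ (n + 1)).1) ∧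
      ∀ n ≤ s, (splice γ s δ n).1 = (γ n).1 := by
  refine ⟨fun n => ?_, fun n => ?_, fun n hn => ?_⟩
  · unfold splice
    split_ifs
    · exact hγ _
    · exact hδ _
  · unfold splice
    rcases lt_trichotomy (n + 1) s with hn | hn | hn
    · rw [if_pos (by omega), if_pos hn, hγ']
    · rw [if_pos (by omega), if_neg (by omega), hγ', hn, h, Nat.sub_self]
    · rw [if_neg (by omega), if_neg (by omega), hδ', show n + 1 - s = n - s + 1 by omega]
  · unfold splice
    split_ifs with h1
    · rfl
    · obtain rfl : n = s := by omega
      rw [h, Nat.sub_self]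

/-- Two portions of a run of a one-to-one compressor between the same states, with the same output,
have the same input as soon as the lengths agree. -/
theorem input_eq_of_output_eq (hC : C.OneToOne) (hγ : C.IsAccRunOn γ x) {s t s' t' : ℕ}
    (hst : s ≤ t) (hst' : s' ≤ t') (hs : (γ s).1 = (γ s').1) (ht : (γ t).1 = (γ t').1)
    {o : List D} (ho : c2out γ t = c2out γ s ++ o) (ho' : c2out γ t' = c2out γ s' ++ o)
    {u u' : List A} (hu : c2in γ t = c2in γ s ++ u) (hu' : c2in γ t' = c2in γ s' ++ u')
    (hlen : u.length = u'.length) : u = u' := by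
  obtain ⟨h0, h1, h2, h3, h4, h5⟩ := hγ
  obtain ⟨p1, p2, p3⟩ := splice_path (C := C) (δ := fun j => γ (t + j)) h1 h2 (fun _ => h1 _)
    (fun _ => h2 _) ht.symm
  set ζ := splice γ t' fun j => γ (t + j) with hζ
  obtain ⟨q1, q2, q3⟩ := splice_path (C := C) (s := s) (δ := fun j => ζ (s' + j)) h1 h2
    (fun _ => p1 _) (fun _ => p2 _) (hs.trans (p3 s' hst').symm)
  set γ' := splice γ s fun j => ζ (s' + j) with hγ'
  have hin : ∀ n, c2in γ' (s + (t' - s' + n)) =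
      c2in γ s ++ (u' ++ c2in (fun j => γ (t + j)) n) := by
    simp only [c2in_eq_word] at hu' ⊢
    exact fun n => word_splice_splice hst' n hu'
  have hout : ∀ n, c2out γ' (s + (t' - s' + n)) = c2out γ (t + n) := by
    intro n
    rw [c2out_eq_word] at ho' ho ⊢
    rw [c2out_eq_word, word_splice_splice hst' n ho', word_add, ho, List.append_assoc]
  have hinγ : ∀ n, c2in γ (t + n) = c2in γ s ++ (u ++ c2in (fun j => γ (t + j)) n) := by
    intro n
    simp only [c2in_eq_word] at hu ⊢
    rw [word_add, hu, List.append_assoc]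
  have hinlen : ∀ n, (c2in γ' (s + (t' - s' + n))).length = (c2in γ (t + n)).length := by
    intro n
    rw [hin, hinγ]
    simp [hlen]
  have hmono : ∀ m n, m ≤ n → c2in γ' m <+: c2in γ' n := by
    intro m n h
    rw [c2in_eq_word]
    exact word_prefix_word h
  have hmono' : ∀ {δ : ℕ → Q × Option A × List D × Q} {m n : ℕ}, m ≤ n →
      c2out δ m <+: c2out δ n := fun h => word_prefix_word h
  have hinf : Tendsto (fun n => (c2in γ' n).length) atTop atTop := by
    refine tendsto_atTop_atTop_of_monotone (fun m n h => (hmono m n h).length_le) fun b => ?_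
    obtain ⟨n, hn⟩ := ((tendsto_add_atTop_iff_nat t).mpr h4).eventually_ge_atTop b |>.exists
    exact ⟨s + (t' - s' + n), by rwa [hinlen, add_comm]⟩
  have hinf' : Tendsto (fun n => (c2out γ' n).length) atTop atTop := by
    refine tendsto_atTop_atTop_of_monotone (fun m n h => (hmono' h).length_le) fun b => ?_
    obtain ⟨n, hn⟩ := ((tendsto_add_atTop_iff_nat t).mpr h5).eventually_ge_atTop b |>.exists
    exact ⟨s + (t' - s' + n), by rwa [hout, add_comm]⟩
  obtain ⟨x', hx'⟩ := exists_eq_pref hmono hinf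
  have hxx : x = x' := by
    refine hC x x' γ γ' ⟨h0, h1, h2, h3, h4, h5⟩
      ⟨(q3 0 (Nat.zero_le _)).trans h0, q1, q2, hx', hinf, hinf'⟩ (fun n => ?_) fun n => ?_
    · exact ⟨s + (t' - s' + n), by rw [hout]; exact hmono' (by omega)⟩
    · exact ⟨t + n, by rw [← hout]; exact hmono' (by omega)⟩
  have e1 := hx' (s + (t' - s' + 0))
  rw [hinlen, ← hxx, ← h3, hin, hinγ] at e1
  exact (List.append_inj (List.append_cancel_left e1) hlen.symm).1.symm

end Comp2

theorem card_length_lt_le (d : ℕ) (hd : 2 ≤ d) (K : ℕ) :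
    (List.finite_length_lt (Fin d) K).toFinset.card ≤ d ^ K := by
  have h : (List.finite_length_lt (Fin d) K).toFinset ⊆
      (Finset.range K).biUnion fun k => Finset.univ.image fun v : Fin k → Fin d => List.ofFn v := by
    intro l hl
    rw [Set.Finite.mem_toFinset] at hl
    simp only [Finset.mem_biUnion, Finset.mem_range, Finset.mem_image, Finset.mem_univ, true_and]
    exact ⟨l.length, hl, l.get, List.ofFn_get l⟩
  refine (Finset.card_le_card h).trans (Finset.card_biUnion_le.trans ?_)
  refine (Finset.sum_le_sum fun k _ => Finset.card_image_le).trans ?_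
  simp only [Finset.card_univ, Fintype.card_fun, Fintype.card_fin]
  clear h
  induction K with
  | zero => simp
  | succ K ih =>
    rw [Finset.sum_range_succ, pow_succ]
    nlinarith [Nat.zero_le (d ^ K)]

theorem exists_block_length (c N d : ℝ) (hN : 1 < N) (hd : 1 < d) {ε : ℝ}
    (hε : 0 < ε) (hε1 : ε < 1) :
    ∃ ℓ K : ℕ, 1 ≤ ℓ ∧ c * d ^ K < ε * N ^ ℓ ∧
      (1 - 2 * ε) * ℓ * Real.log N ≤ K * Real.log d := by
  have hN' := Real.log_pos hN
  have hd' := Real.log_pos hd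
  have t1 : Tendsto (fun ℓ : ℕ => (ℓ : ℝ) * (ε * Real.log N)) atTop atTop :=
    tendsto_natCast_atTop_atTop.atTop_mul_const (by positivity)
  have t2 := Real.tendsto_exp_atTop.comp t1
  obtain ⟨ℓ, h1, h2, h3⟩ := ((eventually_ge_atTop 1).and
    ((t1.eventually_ge_atTop (Real.log d)).and (t2.eventually_gt_atTop (|c| / ε)))).exists
  have hnn : 0 ≤ (1 - ε) * ℓ * Real.log N / Real.log d := by
    have : 0 ≤ 1 - ε := by linarith
    positivity
  refine ⟨ℓ, ⌊(1 - ε) * ℓ * Real.log N / Real.log d⌋₊, h1, ?_, ?_⟩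
  · have hK := Nat.floor_le hnn
    set K := ⌊(1 - ε) * ℓ * Real.log N / Real.log d⌋₊
    rw [le_div_iff₀ hd'] at hK
    have e1 : d ^ K = Real.exp (K * Real.log d) := by
      rw [Real.exp_nat_mul, Real.exp_log (by linarith)]
    have e2 : N ^ ℓ = Real.exp (ℓ * Real.log N) := by
      rw [Real.exp_nat_mul, Real.exp_log (by linarith)]
    have e3 : d ^ K ≤ Real.exp ((1 - ε) * ℓ * Real.log N) := by
      rw [e1]; exact Real.exp_le_exp.mpr hK
    rw [div_lt_iff₀ hε] at h3
    have e4 : N ^ ℓ = Real.exp (ℓ * (ε * Real.log N)) * Real.exp ((1 - ε) * ℓ * Real.log N) := by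
      rw [e2, ← Real.exp_add]; ring_nf
    calc c * d ^ K ≤ |c| * d ^ K := by gcongr; exact le_abs_self c
      _ ≤ |c| * Real.exp ((1 - ε) * ℓ * Real.log N) := by gcongr
      _ < Real.exp (ℓ * (ε * Real.log N)) * ε * Real.exp ((1 - ε) * ℓ * Real.log N) := by
        gcongr; exact h3
      _ = ε * N ^ ℓ := by rw [e4]; ring
  · have hK := (Nat.sub_one_lt_floor ((1 - ε) * ℓ * Real.log N / Real.log d)).le
    have := mul_le_mul_of_nonneg_right hK hd'.le
    rw [sub_mul, div_mul_cancel₀ _ hd'.ne'] at this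
    linarith

theorem pref_add (x : ℕ → A) (m n : ℕ) : pref x (m + n) = pref x m ++ pref (fun i => x (m + i)) n := by
  simp [pref, List.range_add, Function.comp_def]

/-- The number of aligned blocks equal to `u` is at most the number of aligned occurrences. -/
theorem card_filter_le_alocc [DecidableEq A] (x : ℕ → A) {ℓ : ℕ} (hℓ : 1 ≤ ℓ) {u : List A}
    (hu : u.length = ℓ) (n : ℕ) :
    ((Finset.range n).filter fun j => pref (fun i => x (j * ℓ + i)) ℓ = u).card ≤
      alocc (pref x (n * ℓ)) u := by
  have hfin : {i : ℕ | i + u.length ≤ (pref x (n * ℓ)).length ∧ i % u.length = 0 ∧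
      ((pref x (n * ℓ)).drop i).take u.length = u}.Finite :=
    (Set.finite_Iic (n * ℓ)).subset fun i hi => by
      have := hi.1
      rw [pref_length] at this
      exact Set.mem_Iic.mpr (by omega)
  rw [alocc, ← Set.ncard_coe_finset, Nat.card_coe_set_eq]
  refine Set.ncard_le_ncard_of_injOn (fun j => j * ℓ) ?_ ?_ hfin
  · intro j hj
    simp only [Finset.coe_filter, Finset.mem_range, Set.mem_ofPred_eq] at hj
    obtain ⟨hj, he⟩ := hj
    obtain ⟨r, rfl⟩ := Nat.exists_eq_add_of_lt hj
    have e : (j + r + 1) * ℓ = j * ℓ + (ℓ + r * ℓ) := by ring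
    refine ⟨?_, ?_, ?_⟩
    · rw [pref_length, hu, e]
      omega
    · rw [hu]
      exact Nat.mul_mod_left j ℓ
    · rw [e, pref_add, List.drop_left' (pref_length _ _), pref_add,
        List.take_left' (by rw [pref_length, hu]), he]
  · intro i _ j _ h
    exact Nat.eq_of_mul_eq_mul_right (by omega) h

theorem exists_firstTime {γ : ℕ → Q × Option A × List D × Q}
    (h : Tendsto (fun n => (c2in γ n).length) atTop atTop) (j : ℕ) :
    ∃ n, (c2in γ n).length = j ∧ ∀ m, j ≤ (c2in γ m).length → n ≤ m := by
  classical
  have hex : ∃ n, j ≤ (c2in γ n).length := (h.eventually_ge_atTop j).exists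
  refine ⟨Nat.find hex, le_antisymm ?_ (Nat.find_spec hex), fun m hm => Nat.find_min' hex hm⟩
  rcases hn : Nat.find hex with _ | n
  · simp [c2in]
  · have h1 := Nat.find_min hex (m := n) (by omega)
    rw [c2in_eq_word] at h1 ⊢
    rw [word_succ, List.length_append]
    have : (γ n).2.1.toList.length ≤ 1 := by cases (γ n).2.1 <;> simp
    omega

theorem eventually_ratio_ge [Fintype A] {x : ℕ → A} (hx : Normal x) (hA : 2 ≤ Fintype.card A)
    {m d : ℕ} (hd : 2 ≤ d) {C : Comp2 A (Fin d) (Fin m)} (hC : C.OneToOne)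
    {γ : ℕ → Fin m × Option A × List (Fin d) × Fin m} (hγ : C.IsAccRunOn γ x) {ε : ℝ}
    (hε : 0 < ε) (hε1 : 2 * ε < 1) :
    ∀ᶠ n in atTop, (1 - ε) ^ 2 * (1 - 2 * ε) ≤
      (((c2out γ n).length : ℝ) * Real.log d) /
        (((c2in γ n).length : ℝ) * Real.log (Fintype.card A)) := by
  classical
  have hN : (2 : ℝ) ≤ Fintype.card A := by exact_mod_cast hA
  have hd2 : (2 : ℝ) ≤ d := by exact_mod_cast hd
  obtain ⟨ℓ, K, hℓ, hK, hK'⟩ := exists_block_length (m * m) (Fintype.card A) d (by linarith)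
    (by linarith) hε (by linarith)
  choose T hT hTmin using exists_firstTime hγ.2.2.2.2.1
  have hTle : ∀ i j, i ≤ j → T i ≤ T j := fun i j h => hTmin i _ (by rw [hT]; exact h)
  let blk : ℕ → List A := fun j => pref (fun i => x (j * ℓ + i)) ℓ
  have hblk : ∀ j, c2in γ (T ((j + 1) * ℓ)) = c2in γ (T (j * ℓ)) ++ blk j := by
    intro j
    rw [hγ.2.2.2.1, hT, hγ.2.2.2.1 (T (j * ℓ)), hT, add_mul, one_mul, pref_add]
  have hseg : ∀ j, ∃ o, c2out γ (T (j * ℓ)) ++ o = c2out γ (T ((j + 1) * ℓ)) := fun j =>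
    word_prefix_word (hTle _ _ (Nat.mul_le_mul_right _ (by omega)))
  choose o ho using hseg
  let bad : Finset (List A) :=
    (List.finite_length_eq A ℓ).toFinset.filter fun u => ∃ j, blk j = u ∧ (o j).length < K
  have hbad : ∀ j, (o j).length < K → blk j ∈ bad := fun j hj => by
    simp only [bad, Finset.mem_filter, Set.Finite.mem_toFinset]
    exact ⟨pref_length _ _, j, rfl, hj⟩
  have hcard : bad.card ≤ m * m * d ^ K := by
    have hch : ∀ u : List A, ∃ j, u ∈ bad → blk j = u ∧ (o j).length < K := fun u => by
      by_cases hu : u ∈ bad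
      · obtain ⟨j, hj⟩ := (Finset.mem_filter.mp hu).2
        exact ⟨j, fun _ => hj⟩
      · exact ⟨0, fun h => absurd h hu⟩
    choose J hJ using hch
    have := Finset.card_le_card_of_injOn (s := bad)
      (t := (Finset.univ : Finset (Fin m × Fin m)) ×ˢ (List.finite_length_lt (Fin d) K).toFinset)
      (fun u => (((γ (T (J u * ℓ))).1, (γ (T ((J u + 1) * ℓ))).1), o (J u)))
      (fun u hu => by
        rw [Finset.mem_coe, Finset.mem_product, Set.Finite.mem_toFinset]
        exact ⟨Finset.mem_univ _, (hJ u hu).2⟩)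
      (by
        intro u hu v hv h
        simp only [Prod.mk.injEq] at h
        obtain ⟨⟨h1, h2⟩, h3⟩ := h
        rw [← (hJ u hu).1, ← (hJ v hv).1]
        refine input_eq_of_output_eq hC hγ
          (hTle _ _ (Nat.mul_le_mul_right ℓ (Nat.le_succ (J u))))
          (hTle _ _ (Nat.mul_le_mul_right ℓ (Nat.le_succ (J v)))) h1 h2
          (ho (J u)).symm (by rw [h3]; exact (ho (J v)).symm) (hblk _) (hblk _) ?_
        rw [pref_length, pref_length])
    rw [Finset.card_product, Finset.card_univ, Fintype.card_prod, Fintype.card_fin] at this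
    exact this.trans (Nat.mul_le_mul_left _ (card_length_lt_le d hd K))
  let b : ℕ → ℕ := fun n => ((Finset.range n).filter fun j => (o j).length < K).card
  have hout : ∀ n, K * n ≤ (c2out γ (T (n * ℓ))).length + K * b n := by
    intro n
    induction n with
    | zero => simp
    | succ n ih =>
      rw [← ho n, List.length_append]
      simp only [b, Finset.range_add_one, Finset.filter_insert]
      split_ifs with h
      · rw [Finset.card_insert_of_notMem (by simp)]
        simp only [b] at ih
        linarith
      · simp only [b] at ih
        push Not at h
        linarith
  have hb : ∀ n, b n ≤ ∑ u ∈ bad, alocc (pref x (n * ℓ)) u := by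
    intro n
    have h1 : ((Finset.range n).filter fun j => (o j).length < K) ⊆
        bad.biUnion fun u => (Finset.range n).filter fun j => blk j = u := by
      intro j hj
      rw [Finset.mem_filter] at hj
      rw [Finset.mem_biUnion]
      exact ⟨blk j, hbad j hj.2, Finset.mem_filter.mpr ⟨hj.1, rfl⟩⟩
    refine (Finset.card_le_card h1).trans (Finset.card_biUnion_le.trans ?_)
    refine Finset.sum_le_sum fun u hu => card_filter_le_alocc x hℓ ?_ n
    simpa using (Finset.mem_filter.mp hu).1
  have hlim : Tendsto (fun n : ℕ => ∑ u ∈ bad, (alocc (pref x (n * ℓ)) u : ℝ) / n) atTop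
      (𝓝 (∑ _u ∈ bad, (Fintype.card A : ℝ)⁻¹ ^ ℓ)) :=
    tendsto_finsetSum _ fun u hu => hx ℓ hℓ u (by simpa using (Finset.mem_filter.mp hu).1)
  have hlt : ∑ _u ∈ bad, (Fintype.card A : ℝ)⁻¹ ^ ℓ < ε := by
    rw [Finset.sum_const, nsmul_eq_mul, inv_pow, ← div_eq_mul_inv, div_lt_iff₀ (by positivity)]
    refine lt_of_le_of_lt ?_ hK
    exact_mod_cast hcard
  have hdens : ∀ᶠ n : ℕ in atTop, (b n : ℝ) ≤ ε * n := by
    filter_upwards [hlim.eventually_lt_const hlt, eventually_gt_atTop 0] with n hn hn0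
    rw [← Finset.sum_div, div_lt_iff₀ (by exact_mod_cast hn0)] at hn
    refine le_trans ?_ hn.le
    exact_mod_cast hb n
  have hfrac : ∀ᶠ n : ℕ in atTop, (1 - ε) * (n + 1) ≤ n := by
    filter_upwards [eventually_ge_atTop ⌈1 / ε⌉₊] with n hn
    have := (Nat.le_ceil (1 / ε)).trans (Nat.cast_le.mpr hn)
    rw [div_le_iff₀ hε] at this
    linarith
  have hquot : Tendsto (fun r => (c2in γ r).length / ℓ) atTop atTop :=
    (Nat.tendsto_div_const_atTop (by omega)).comp hγ.2.2.2.2.1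
  filter_upwards [hquot.eventually (hdens.and hfrac),
    hγ.2.2.2.2.1.eventually_gt_atTop 0] with r hr hr0
  obtain ⟨hr1, hr2⟩ := hr
  set n := (c2in γ r).length / ℓ with hn
  have hlogN : 0 < Real.log (Fintype.card A) := Real.log_pos (by linarith)
  have hlogd : 0 < Real.log d := Real.log_pos (by linarith)
  have hr0' : (0 : ℝ) < (c2in γ r).length := by exact_mod_cast hr0
  have h1 : ((c2in γ r).length : ℝ) ≤ (n + 1) * ℓ := by
    have := Nat.lt_div_mul_add (a := (c2in γ r).length) (b := ℓ) (by omega)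
    rw [← hn] at this
    have h2 : (c2in γ r).length ≤ (n + 1) * ℓ := by linarith
    exact_mod_cast h2
  have h2 : (K : ℝ) * ((1 - ε) * n) ≤ (c2out γ r).length := by
    have e1 : (c2out γ (T (n * ℓ))).length ≤ (c2out γ r).length :=
      (word_prefix_word (hTmin _ _ (Nat.div_mul_le_self _ _))).length_le
    have e2 : K * n ≤ (c2out γ r).length + K * b n := by
      have := hout n
      omega
    have e3 : (K : ℝ) * n ≤ (c2out γ r).length + K * b n := by exact_mod_cast e2
    have e4 := mul_le_mul_of_nonneg_left hr1 (Nat.cast_nonneg (α := ℝ) K)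
    linarith
  rw [le_div_iff₀ (by positivity)]
  have hε0 : 0 ≤ 1 - ε := by linarith
  have hε2 : 0 ≤ 1 - 2 * ε := by linarith
  calc (1 - ε) ^ 2 * (1 - 2 * ε) * (((c2in γ r).length : ℝ) * Real.log (Fintype.card A))
      ≤ (1 - ε) ^ 2 * (1 - 2 * ε) * (((n + 1) * ℓ) * Real.log (Fintype.card A)) := by gcongr
    _ = (1 - ε) * ((1 - ε) * (n + 1)) * ((1 - 2 * ε) * ℓ * Real.log (Fintype.card A)) := by ring
    _ ≤ (1 - ε) * n * (K * Real.log d) := by gcongr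
    _ = K * ((1 - ε) * n) * Real.log d := by ring
    _ ≤ (c2out γ r).length * Real.log d := by gcongr

theorem rho_bddBelow [Fintype A] (x : ℕ → A) :
    BddBelow {r : ℝ | ∃ (m d : ℕ), 2 ≤ d ∧ ∃ C : Comp2 A (Fin d) (Fin m),
    C.OneDet ∧ C.OneToOne ∧ ∃ γ, C.IsAccRunOn γ x ∧
      r = Filter.liminf (fun n : ℕ =>
        (((c2out γ n).length : ℝ) * Real.log d) /
        (((c2in γ n).length : ℝ) * Real.log (Fintype.card A))) atTop} := by
  refine ⟨0, ?_⟩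
  rintro _ ⟨m, d, hd, C, -, -, δ, -, rfl⟩
  exact liminf_nonneg fun n => by
    have := Real.log_natCast_nonneg d
    have := Real.log_natCast_nonneg (Fintype.card A)
    positivity

theorem two_le_card_of_rho_pos [Fintype A] {x : ℕ → A} (h : 0 < rho x) : 2 ≤ Fintype.card A := by
  by_contra hcon
  have hlog : Real.log (Fintype.card A) = 0 := by
    have : Fintype.card A = 0 ∨ Fintype.card A = 1 := by omega
    rcases this with h | h <;> simp [h]
  refine absurd h (not_lt.mpr ?_)
  unfold rho
  simp only [hlog, mul_zero, div_zero]
  refine Real.sInf_nonpos ?_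
  rintro _ ⟨m, d, hd, C, -, -, δ, -, rfl⟩
  exact (liminf_const (0 : ℝ)).le

/-- A normal word cannot be compressed by a finite-state compressor. -/
theorem one_le_rho [Fintype A] {x : ℕ → A} (hx : Normal x) (h : 0 < rho x) : 1 ≤ rho x := by
  have hA := two_le_card_of_rho_pos h
  refine le_csInf ?_ ?_
  · by_contra hne
    rw [Set.not_nonempty_iff_eq_empty] at hne
    rw [rho, hne, Real.sInf_empty] at h
    exact lt_irrefl _ h
  · intro r hr
    have hr0 : 0 < r := h.trans_le (csInf_le (rho_bddBelow x) hr)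
    obtain ⟨m, d, hd, C, -, hC, γ, hγ, rfl⟩ := hr
    rw [liminf_eq] at hr0 ⊢
    have hbdd : BddAbove {a : ℝ | ∀ᶠ n in atTop, a ≤ (((c2out γ n).length : ℝ) * Real.log d) /
        (((c2in γ n).length : ℝ) * Real.log (Fintype.card A))} := by
      by_contra hb
      rw [Real.sSup_of_not_bddAbove hb] at hr0
      exact lt_irrefl _ hr0
    have hlim : Tendsto (fun ε : ℝ => (1 - ε) ^ 2 * (1 - 2 * ε)) (𝓝[>] 0) (𝓝 1) := by
      refine Tendsto.mono_left ?_ nhdsWithin_le_nhds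
      have : Continuous fun ε : ℝ => (1 - ε) ^ 2 * (1 - 2 * ε) := by fun_prop
      simpa using this.tendsto 0
    refine le_of_tendsto hlim ?_
    filter_upwards [Ioo_mem_nhdsGT (show (0 : ℝ) < 1 / 2 by norm_num)] with ε hε
    exact le_csSup hbdd (eventually_ratio_ge hx hA hd hC hγ hε.1 (by linarith [hε.2]))

/-! ### Exchanging the two tapes -/

/-- Exchange the two tapes in a transition. -/
def flipTrans (τ : Q × (Option A × Option B) × Q) : Q × (Option B × Option A) × Q :=
  (τ.1, τ.2.1.swap, τ.2.2)

/-- Exchange the two tapes of an automaton. -/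
def TwoAut.swap (M : TwoAut A B Q) : TwoAut B A Q where
  init := M.init
  trans := {τ | flipTrans τ ∈ M.trans}

theorem TwoAut.TwoDet.swap {M : TwoAut A B Q} (h : M.TwoDet) : M.swap.TwoDet := by
  refine ⟨h.1, ?_⟩
  rintro ⟨q, ⟨b, a⟩, r⟩ hτ ⟨q', ⟨b', a'⟩, r'⟩ hτ' heq
  obtain ⟨h1, h2⟩ := h.2 _ hτ _ hτ' heq
  simp only [flipTrans, lsupp, Prod.swap_prod_mk, Prod.mk.injEq] at h1 h2 ⊢
  exact ⟨⟨h1.2, h1.1⟩, fun h => ⟨(h2 ⟨h.2, h.1⟩).1, h, (h2 ⟨h.2, h.1⟩).2.2⟩⟩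

theorem TwoAut.IsRunOn.swap {M : TwoAut A B Q} {γ : ℕ → Q × (Option A × Option B) × Q}
    {x : ℕ → A} {y : ℕ → B} (h : M.IsRunOn γ x y) :
    M.swap.IsRunOn (fun n => flipTrans (γ n)) y x :=
  ⟨h.1, h.2.1, h.2.2.2.1, h.2.2.1, h.2.2.2.2.2, h.2.2.2.2.1⟩

theorem tendsto_cnt_div_snd [Fintype A] [Fintype B] [Fintype Q] {x : ℕ → A} {y : ℕ → B}
    (hρ : 1 ≤ condRho y x) (hB : 2 ≤ Fintype.card B) {M : TwoAut A B Q} (hdet : M.TwoDet)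
    {γ : ℕ → Q × (Option A × Option B) × Q} (hγ : M.IsRunOn γ x y)
    (sp : Q → Option A → Bool) (b₀ : B) {k : ℕ → ℕ} (hk : Tendsto k atTop atTop) {c : ℝ}
    (hc : 0 < c)
    (hS : ∀ᶠ n in atTop,
      c * k n ≤ cnt (fun τ => τ.2.1.2.isSome ∧ sp τ.1 τ.2.1.1 = true) γ (k n)) :
    Tendsto (fun n => (cnt (fun τ => τ.2.1.2 = some b₀ ∧ sp τ.1 τ.2.1.1 = true) γ (k n) : ℝ) /
      cnt (fun τ => τ.2.1.2.isSome ∧ sp τ.1 τ.2.1.1 = true) γ (k n)) atTop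
      (𝓝 (Fintype.card B : ℝ)⁻¹) :=
  tendsto_cnt_div hρ hB hdet.swap hγ.swap sp b₀ hk hc hS

/-- The limiting relative frequency of a transition only depends on its support. -/
theorem tendsto_transCount_div [Fintype A] [Fintype B] [Fintype Q] {x : ℕ → A} {y : ℕ → B}
    (hρ : 1 ≤ condRho x y) (hA : 2 ≤ Fintype.card A)
    (hρ' : 1 ≤ condRho y x) (hB : 2 ≤ Fintype.card B) {M : TwoAut A B Q} (hdet : M.TwoDet)
    {γ : ℕ → Q × (Option A × Option B) × Q} (hγ : M.IsRunOn γ x y)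
    {σ : Q × (Option A × Option B) × Q} (hσ : σ ∈ M.trans) {k : ℕ → ℕ}
    (hk : Tendsto k atTop atTop) {c : ℝ} (hc : 0 < c)
    (hS : ∀ᶠ n in atTop, c * k n ≤ stateCount γ σ.1 (k n)) :
    Tendsto (fun n => (transCount γ σ (k n) : ℝ) / stateCount γ σ.1 (k n)) atTop
      (𝓝 ((if σ.2.1.1.isSome then (Fintype.card A : ℝ)⁻¹ else 1) *
        if σ.2.1.2.isSome then (Fintype.card B : ℝ)⁻¹ else 1)) := by
  classical
  have hB0 : (0 : ℝ) < (Fintype.card B : ℝ)⁻¹ := inv_pos.mpr (by exact_mod_cast (by omega))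
  have hlab : ∀ i, γ i = σ ↔ (γ i).1 = σ.1 ∧ (γ i).2.1 = σ.2.1 := fun i =>
    ⟨fun h => by simp [h], fun h => (hdet.2 _ (hγ.1 i) _ hσ h.1).2 h.2⟩
  have hsupp : ∀ i, (γ i).1 = σ.1 → (γ i).2.1.1.isSome = σ.2.1.1.isSome ∧
      (γ i).2.1.2.isSome = σ.2.1.2.isSome := fun i h => by
    simpa [lsupp] using (hdet.2 _ (hγ.1 i) _ hσ h).1
  have htc : ∀ n, transCount γ σ n = cnt (fun τ => τ.1 = σ.1 ∧ τ.2.1 = σ.2.1) γ n := fun n =>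
    cnt_congr (P := fun τ => τ = σ) hlab n
  have hpos : ∀ {c : ℝ} {P : Q × (Option A × Option B) × Q → Prop}, 0 < c →
      (∀ᶠ n in atTop, c * k n ≤ cnt P γ (k n)) → ∀ᶠ n in atTop, (0 : ℝ) < cnt P γ (k n) := by
    intro c P hc h
    filter_upwards [h, hk.eventually_gt_atTop 0] with n h1 h2
    exact lt_of_lt_of_le (mul_pos hc (by exact_mod_cast h2)) h1
  have hsc : ∀ n, stateCount γ σ.1 n = cnt (fun τ => τ.1 = σ.1) γ n := fun _ => rfl
  simp only [htc, hsc] at hS ⊢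
  obtain ⟨p, ⟨a, b⟩, q⟩ := σ
  simp only at hlab hsupp hS ⊢
  rcases a with _ | a <;> rcases b with _ | b
  · have : ∀ n, cnt (fun τ => τ.1 = p ∧ τ.2.1 = (none, none)) γ n = cnt (fun τ => τ.1 = p) γ n :=
      cnt_congr fun i => by
        have := hsupp i
        revert this
        rcases γ i with ⟨r, ⟨_ | a', _ | b'⟩, r'⟩ <;> simp
    simp only [this, Option.isSome_none, Bool.false_eq_true, if_false, mul_one]
    refine tendsto_const_nhds.congr' ?_
    filter_upwards [hpos hc hS] with n hn
    rw [div_self hn.ne']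
  · have e1 : ∀ n, cnt (fun τ => τ.1 = p ∧ τ.2.1 = (none, some b)) γ n =
        cnt (fun τ => τ.2.1.2 = some b ∧ decide (τ.1 = p) = true) γ n := cnt_congr fun i => by
      have := hsupp i
      revert this
      rcases γ i with ⟨r, ⟨_ | a', _ | b'⟩, r'⟩ <;> simp <;> tauto
    have e2 : ∀ n, cnt (fun τ => τ.1 = p) γ n =
        cnt (fun τ => τ.2.1.2.isSome ∧ decide (τ.1 = p) = true) γ n := cnt_congr fun i => by
      have := hsupp i
      revert this
      rcases γ i with ⟨r, ⟨_ | a', _ | b'⟩, r'⟩ <;> simp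
    simp only [e1, e2] at hS ⊢
    simpa using tendsto_cnt_div_snd hρ' hB hdet hγ (fun r _ => decide (r = p)) b hk hc hS
  · have e1 : ∀ n, cnt (fun τ => τ.1 = p ∧ τ.2.1 = (some a, none)) γ n =
        cnt (fun τ => τ.2.1.1 = some a ∧ decide (τ.1 = p) = true) γ n := cnt_congr fun i => by
      have := hsupp i
      revert this
      rcases γ i with ⟨r, ⟨_ | a', _ | b'⟩, r'⟩ <;> simp <;> tauto
    have e2 : ∀ n, cnt (fun τ => τ.1 = p) γ n =
        cnt (fun τ => τ.2.1.1.isSome ∧ decide (τ.1 = p) = true) γ n := cnt_congr fun i => by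
      have := hsupp i
      revert this
      rcases γ i with ⟨r, ⟨_ | a', _ | b'⟩, r'⟩ <;> simp
    simp only [e1, e2] at hS ⊢
    simpa using tendsto_cnt_div hρ hA hdet hγ (fun r _ => decide (r = p)) a hk hc hS
  · have e1 : ∀ n, cnt (fun τ => τ.1 = p ∧ τ.2.1 = (some a, some b)) γ n =
        cnt (fun τ => τ.2.1.1 = some a ∧ decide (τ.1 = p ∧ τ.2.1.2 = some b) = true) γ n :=
      cnt_congr fun i => by
        have := hsupp i
        revert this
        rcases γ i with ⟨r, ⟨_ | a', _ | b'⟩, r'⟩ <;> simp; tauto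
    have e2 : ∀ n, cnt (fun τ => τ.1 = p) γ n =
        cnt (fun τ => τ.2.1.2.isSome ∧ decide (τ.1 = p) = true) γ n := cnt_congr fun i => by
      have := hsupp i
      revert this
      rcases γ i with ⟨r, ⟨_ | a', _ | b'⟩, r'⟩ <;> simp
    have e3 : ∀ n, cnt (fun τ => τ.2.1.2 = some b ∧ decide (τ.1 = p) = true) γ n =
        cnt (fun τ => τ.2.1.1.isSome ∧ decide (τ.1 = p ∧ τ.2.1.2 = some b) = true) γ n :=
      cnt_congr fun i => by
        have := hsupp i
        revert this
        rcases γ i with ⟨r, ⟨_ | a', _ | b'⟩, r'⟩ <;> simp <;> tauto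
    simp only [e1, e2] at hS ⊢
    have h1 := tendsto_cnt_div_snd hρ' hB hdet hγ (fun r _ => decide (r = p)) b hk hc hS
    simp only [e3] at h1
    have hc' : 0 < c * ((Fintype.card B : ℝ)⁻¹ / 2) := by positivity
    have hS' : ∀ᶠ n in atTop, c * ((Fintype.card B : ℝ)⁻¹ / 2) * k n ≤
        cnt (fun τ => τ.2.1.1.isSome ∧ decide (τ.1 = p ∧ τ.2.1.2 = some b) = true) γ (k n) := by
      filter_upwards [h1.eventually_const_lt (half_lt_self hB0), hS, hpos hc hS] with n h2 h3 h4
      rw [lt_div_iff₀ h4] at h2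
      have := mul_le_mul_of_nonneg_left h3 (half_pos hB0).le
      linarith
    have h2 := tendsto_cnt_div hρ hA hdet hγ (fun r β => decide (r = p ∧ β = some b)) a hk hc' hS'
    simp only [Option.isSome_some, if_true]
    refine (h2.mul h1).congr' ?_
    filter_upwards [hpos hc' hS'] with n hn
    exact div_mul_div_cancel₀ hn.ne'

/-- In the run of a `2`-deterministic `2`-automaton on two
finite-state independent normal words, any two transitions leaving the same state
occur with the same limiting frequency relative to that state (along any increasing
sequence of times where the state has positive limiting frequency). -/
theorem freq_trans_of_fsIndep {A B Q : Type*} [Fintype A] [Fintype B] [Fintype Q]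
    (x : ℕ → A) (y : ℕ → B) (hx : Normal x) (hy : Normal y) (hind : FSIndep x y)
    (M : TwoAut A B Q) (hdet : M.TwoDet)
    (γ : ℕ → Q × (Option A × Option B) × Q)
    (hγ0 : (γ 0).1 ∈ M.init) (hrun : M.IsRunOn γ x y)
    (p : Q) (σ σ' : Q × (Option A × Option B) × Q)
    (hσ : σ ∈ M.trans) (hσ' : σ' ∈ M.trans) (hσp : σ.1 = p) (hσ'p : σ'.1 = p)
    (k : ℕ → ℕ) (hk : StrictMono k) (L : ℝ) (hL : 0 < L)
    (hfreq : Tendsto (fun n => (stateCount γ p (k n) : ℝ) / (k n)) atTop (nhds L)) :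
    ∃ c : ℝ,
      Tendsto (fun n => (transCount γ σ (k n) : ℝ) / (stateCount γ p (k n))) atTop
        (nhds c) ∧
      Tendsto (fun n => (transCount γ σ' (k n) : ℝ) / (stateCount γ p (k n))) atTop
        (nhds c) := by
  have hρx := one_le_rho hx hind.2.2.1
  have hρy := one_le_rho hy hind.2.2.2
  have hA := two_le_card_of_rho_pos hind.2.2.1
  have hB := two_le_card_of_rho_pos hind.2.2.2
  rw [← hind.1] at hρx
  rw [← hind.2.1] at hρy
  have hS : ∀ᶠ n in atTop, L / 2 * k n ≤ stateCount γ p (k n) := by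
    filter_upwards [hfreq.eventually_const_lt (half_lt_self hL),
      hk.tendsto_atTop.eventually_gt_atTop 0] with n h1 h2
    exact ((lt_div_iff₀ (by exact_mod_cast h2)).mp h1).le
  have h1 := tendsto_transCount_div hρx hA hρy hB hdet hrun hσ hk.tendsto_atTop (half_pos hL)
    (by rwa [hσp])
  have h2 := tendsto_transCount_div hρx hA hρy hB hdet hrun hσ' hk.tendsto_atTop (half_pos hL)
    (by rwa [hσ'p])
  have hsupp := (hdet.2 σ hσ σ' hσ' (hσp.trans hσ'p.symm)).1
  simp only [lsupp, Prod.mk.injEq] at hsupp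
  rw [hσ'p, ← hsupp.1, ← hsupp.2] at h2
  rw [hσp] at h1
  exact ⟨_, h1, h2⟩

end FSI
end

section
/- Let x and y be normal infinite words over finite alphabets A and B such that for every 2-deterministic 2-automaton with run γ on x and y, every state p, every pair σ, σ′ of transitions starting at p, and every increasing sequence (k_n)_{n≥0} of integers for which lim_{n→∞} occ(γ[1..k_n],p)/k_n exists and is strictly positive, one has lim_{n→∞} occ(γ[1..k_n],σ)/occ(γ[1..k_n],p) = lim_{n→∞} occ(γ[1..k_n],σ′)/occ(γ[1..k_n],p). Then the frequency property holds: for every strongly connected 2-deterministic 2-automaton 𝒜 and every infinite run γ of 𝒜 whose two inputs are a suffix of x and a suffix of y, 𝒜 is 2-complete and for every state q, lim_{n→∞} occ(γ[1..n],q)/n = π(q), where π is the stationary distribution associated with 𝒜. -/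
open Filter Topology

namespace FSI

variable {A B D Q : Type*}

section Counting

variable {S : Type*}

lemma card_lt_and_eq_count (P : ℕ → Prop) [DecidablePred P] (n : ℕ) :
    Nat.card {i : ℕ | i < n ∧ P i} = Nat.count P n := by
  rw [Nat.count_eq_card_filter_range, Nat.card_coe_set_eq, ← Set.ncard_coe_finset]
  congr 1
  ext i
  simp

lemma stateCount_eq_count [DecidableEq Q] (γ : ℕ → Q × (Option A × Option B) × Q) (q : Q) (n : ℕ) :
    stateCount γ q n = Nat.count (fun i => (γ i).1 = q) n :=
  card_lt_and_eq_count _ n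

lemma transCount_eq_count [DecidableEq (Q × (Option A × Option B) × Q)]
    (γ : ℕ → Q × (Option A × Option B) × Q)
    (τ : Q × (Option A × Option B) × Q) (n : ℕ) :
    transCount γ τ n = Nat.count (fun i => γ i = τ) n :=
  card_lt_and_eq_count _ n

lemma count_eq_sum_fiber [Fintype S] [DecidableEq S] (γ : ℕ → S) (P : S → Prop)
    [DecidablePred P] (n : ℕ) :
    Nat.count (fun i => P (γ i)) n = ∑ τ with P τ, Nat.count (fun i => γ i = τ) n := by
  induction n with
  | zero => simp
  | succ n ih =>
    simp only [Nat.count_succ, Finset.sum_add_distrib, ih]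
    congr 1
    simp [Finset.sum_ite_eq]

end Counting

open Classical in
lemma stateCount_eq_sum_transCount [Fintype A] [Fintype B] [Fintype Q]
    (γ : ℕ → Q × (Option A × Option B) × Q) (p : Q) (n : ℕ) :
    stateCount γ p n = ∑ τ with τ.1 = p, transCount γ τ n := by
  simp only [stateCount_eq_count, transCount_eq_count]
  exact count_eq_sum_fiber γ (fun τ => τ.1 = p) n

open Classical in
lemma stateCount_succ_eq_sum_transCount [Fintype A] [Fintype B] [Fintype Q]
    {γ : ℕ → Q × (Option A × Option B) × Q} (h : ∀ n, (γ n).2.2 = (γ (n + 1)).1)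
    (q : Q) (n : ℕ) :
    stateCount γ q (n + 1) =
      (∑ τ with τ.2.2 = q, transCount γ τ n) + if (γ 0).1 = q then 1 else 0 := by
  simp only [stateCount_eq_count, transCount_eq_count, Nat.count_succ', ← h]
  rw [count_eq_sum_fiber γ (fun τ => τ.2.2 = q) n]

lemma transCount_le_stateCount (γ : ℕ → Q × (Option A × Option B) × Q)
    (τ : Q × (Option A × Option B) × Q) (n : ℕ) :
    transCount γ τ n ≤ stateCount γ τ.1 n := by
  classical
  rw [stateCount_eq_count, transCount_eq_count]
  exact Nat.count_mono_left fun i _ hi => by rw [hi]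

lemma transCount_eq_zero {γ : ℕ → Q × (Option A × Option B) × Q}
    {T : Set (Q × (Option A × Option B) × Q)} (h : ∀ n, γ n ∈ T)
    {τ : Q × (Option A × Option B) × Q} (hτ : τ ∉ T) (n : ℕ) : transCount γ τ n = 0 := by
  have : {i : ℕ | i < n ∧ γ i = τ} = ∅ :=
    Set.eq_empty_of_forall_notMem fun i hi => hτ (hi.2 ▸ h i)
  rw [transCount, this]
  simp

lemma stateCount_le (γ : ℕ → Q × (Option A × Option B) × Q) (q : Q) (n : ℕ) :
    stateCount γ q n ≤ n := by
  classical
  rw [stateCount_eq_count]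
  exact Nat.count_le _

lemma sum_stateCount [Fintype Q] (γ : ℕ → Q × (Option A × Option B) × Q) (n : ℕ) :
    ∑ q, stateCount γ q n = n := by
  classical
  simp only [stateCount_eq_count]
  have := count_eq_sum_fiber (fun i => (γ i).1) (fun _ => True) n
  simpa [Nat.count_true] using this.symm

/-- Transitions leaving a common state have the same limiting relative frequency along every
run on `(x, y)`, whatever its first state. -/
def EquiTrans (x : ℕ → A) (y : ℕ → B) : Prop :=
  ∀ (Q : Type) [Fintype Q] (T : Set (Q × (Option A × Option B) × Q)),
    (∀ t ∈ T, ∀ t' ∈ T, t.1 = t'.1 →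
      lsupp t.2.1 = lsupp t'.2.1 ∧ (t.2.1 = t'.2.1 → t = t')) →
    ∀ γ : ℕ → Q × (Option A × Option B) × Q, TwoAut.IsRunOn ⟨{(γ 0).1}, T⟩ γ x y →
    ∀ σ ∈ T, ∀ σ' ∈ T, σ.1 = σ'.1 → ∀ k : ℕ → ℕ, StrictMono k → ∀ L : ℝ, 0 < L →
      Tendsto (fun n => (stateCount γ σ.1 (k n) : ℝ) / (k n)) atTop (𝓝 L) →
      ∃ c : ℝ,
        Tendsto (fun n => (transCount γ σ (k n) : ℝ) / (stateCount γ σ.1 (k n))) atTop (𝓝 c) ∧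
        Tendsto (fun n => (transCount γ σ' (k n) : ℝ) / (stateCount γ σ.1 (k n))) atTop (𝓝 c)

section Prepend

/-- The transition over `Option Q` corresponding to a transition over `Q`. -/
def liftTrans (t : Q × (Option A × Option B) × Q) :
    Option Q × (Option A × Option B) × Option Q := (some t.1, t.2.1, some t.2.2)

/-- The run `γ` preceded by one transition labelled `l` from a fresh state. -/
def prependRun (l : Option A × Option B) (γ : ℕ → Q × (Option A × Option B) × Q) :
    ℕ → Option Q × (Option A × Option B) × Option Q
  | 0 => (none, l, some (γ 0).1)
  | n + 1 => liftTrans (γ n)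

lemma liftTrans_injective :
    Function.Injective (liftTrans : Q × (Option A × Option B) × Q → _) := by
  rintro ⟨p, l, q⟩ ⟨p', l', q'⟩ h
  simpa [liftTrans] using h

lemma stateCount_prependRun (l : Option A × Option B)
    (γ : ℕ → Q × (Option A × Option B) × Q) (p : Q) (n : ℕ) :
    stateCount (prependRun l γ) (some p) (n + 1) = stateCount γ p n := by
  classical
  simp only [stateCount_eq_count, Nat.count_succ']
  simp [prependRun, liftTrans]

lemma transCount_prependRun (l : Option A × Option B)
    (γ : ℕ → Q × (Option A × Option B) × Q) (τ : Q × (Option A × Option B) × Q) (n : ℕ) :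
    transCount (prependRun l γ) (liftTrans τ) (n + 1) = transCount γ τ n := by
  classical
  simp only [transCount_eq_count, Nat.count_succ']
  simp only [prependRun, liftTrans_injective.eq_iff]
  simp [liftTrans]

lemma in1_prependRun_succ (l : Option A × Option B)
    (γ : ℕ → Q × (Option A × Option B) × Q) (n : ℕ) :
    in1 (prependRun l γ) (n + 1) = l.1.toList ++ in1 γ n := by
  obtain ⟨_ | a, b⟩ := l <;>
  simp [in1, List.range_succ_eq_map, prependRun, liftTrans, Function.comp_def,
    List.reduceOption_cons_of_none, List.reduceOption_cons_of_some]

lemma in2_prependRun_succ (l : Option A × Option B)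
    (γ : ℕ → Q × (Option A × Option B) × Q) (n : ℕ) :
    in2 (prependRun l γ) (n + 1) = l.2.toList ++ in2 γ n := by
  obtain ⟨a, _ | b⟩ := l <;>
  simp [in2, List.range_succ_eq_map, prependRun, liftTrans, Function.comp_def,
    List.reduceOption_cons_of_none, List.reduceOption_cons_of_some]

lemma EquiTrans.of_prepend {x x' : ℕ → A} {y y' : ℕ → B} (l : Option A × Option B)
    (hx : ∀ n, l.1.toList ++ pref x' n = pref x (l.1.toList.length + n))
    (hy : ∀ n, l.2.toList ++ pref y' n = pref y (l.2.toList.length + n))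
    (H : EquiTrans x y) : EquiTrans x' y' := by
  intro Q _ T hT γ hγ σ hσ σ' hσ' hp k hk L hL hlim
  obtain ⟨h1, h2, h3, h4, h5, h6⟩ := hγ
  set T' : Set (Option Q × (Option A × Option B) × Option Q) :=
    insert (none, l, some (γ 0).1) (liftTrans '' T) with hT'
  have hdet : ∀ t ∈ T', ∀ t' ∈ T', t.1 = t'.1 →
      lsupp t.2.1 = lsupp t'.2.1 ∧ (t.2.1 = t'.2.1 → t = t') := by
    rintro t (rfl | ⟨t, ht, rfl⟩) t' (rfl | ⟨t', ht', rfl⟩) h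
    · simp
    · simp [liftTrans] at h
    · simp [liftTrans] at h
    · have := hT t ht t' ht' (by simpa [liftTrans] using h)
      exact ⟨this.1, fun h' => congrArg _ (this.2 h')⟩
  have hrun : TwoAut.IsRunOn ⟨{(prependRun l γ 0).1}, T'⟩ (prependRun l γ) x y := by
    refine ⟨?_, ?_, ?_, ?_, ?_, ?_⟩
    · rintro (_ | n)
      · exact Set.mem_insert _ _
      · exact Set.mem_insert_of_mem _ ⟨_, h1 n, rfl⟩
    · rintro (_ | n)
      · rfl
      · exact congrArg some (h2 n)
    · rintro (_ | n)
      · rfl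
      · rw [in1_prependRun_succ, List.length_append, ← hx, ← h3]
    · rintro (_ | n)
      · rfl
      · rw [in2_prependRun_succ, List.length_append, ← hy, ← h4]
    · rw [← tendsto_add_atTop_iff_nat 1]
      simp only [in1_prependRun_succ, List.length_append]
      exact tendsto_atTop_mono (fun n => Nat.le_add_left _ _) h5
    · rw [← tendsto_add_atTop_iff_nat 1]
      simp only [in2_prependRun_succ, List.length_append]
      exact tendsto_atTop_mono (fun n => Nat.le_add_left _ _) h6
  have hfreq : Tendsto (fun n => (stateCount (prependRun l γ) (liftTrans σ).1 (k n + 1) : ℝ) /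
      ((k n + 1 : ℕ) : ℝ)) atTop (𝓝 L) := by
    have hq := (tendsto_natCast_div_add_atTop (1 : ℝ)).comp hk.tendsto_atTop
    have := hlim.mul hq
    rw [mul_one] at this
    refine this.congr' ?_
    filter_upwards [hk.tendsto_atTop.eventually_gt_atTop 0] with n hn
    have : (k n : ℝ) ≠ 0 := by positivity
    change _ = (stateCount (prependRun l γ) (some σ.1) (k n + 1) : ℝ) / _
    rw [stateCount_prependRun]
    simp only [Function.comp]
    push_cast
    field_simp
  have key := H (Option Q) T' hdet (prependRun l γ) hrun (liftTrans σ)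
    (Set.mem_insert_of_mem _ ⟨σ, hσ, rfl⟩) (liftTrans σ')
    (Set.mem_insert_of_mem _ ⟨σ', hσ', rfl⟩) (congrArg some hp) (fun n => k n + 1)
    (hk.add_const 1) L hL hfreq
  have hst : ∀ n, stateCount (prependRun l γ) (liftTrans σ).1 (n + 1) = stateCount γ σ.1 n :=
    fun n => stateCount_prependRun l γ σ.1 n
  simpa only [hst, transCount_prependRun] using key

lemma cons_pref (x : ℕ → A) (n : ℕ) :
    x 0 :: pref (fun m => x (m + 1)) n = pref x (1 + n) := by
  simp [pref, Nat.add_comm 1 n, List.range_succ_eq_map, Function.comp_def]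

lemma EquiTrans.suffix {x : ℕ → A} {y : ℕ → B} (H : EquiTrans x y) (i j : ℕ) :
    EquiTrans (fun n => x (n + i)) (fun n => y (n + j)) := by
  have h1 : EquiTrans (fun n => x (n + i)) y := by
    induction i with
    | zero => exact H
    | succ i ih =>
      refine ih.of_prepend (some (x i), none) (fun n => ?_) (fun n => by simp)
      have := cons_pref (fun m => x (m + i)) n
      simpa [Nat.add_assoc, Nat.add_comm 1 i] using this
  induction j with
  | zero => exact h1
  | succ j ih =>
    refine ih.of_prepend (none, some (y j)) (fun n => by simp) (fun n => ?_)
    have := cons_pref (fun m => y (m + j)) n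
    simpa [Nat.add_assoc, Nat.add_comm 1 j] using this

end Prepend

section Weights

variable [Fintype A] [Fintype B]

/-- The probability of a label reading exactly one symbol. -/
noncomputable def labelWeight : Option A × Option B → ℝ
  | (some _, none) => (Fintype.card A : ℝ)⁻¹
  | (none, some _) => (Fintype.card B : ℝ)⁻¹
  | _ => 0

lemma labelWeight_pos {l : Option A × Option B}
    (h : lsupp l = (true, false) ∨ lsupp l = (false, true)) : 0 < labelWeight l := by
  obtain ⟨_ | a, _ | b⟩ := l <;> simp [lsupp] at h
  · have : 0 < Fintype.card B := Fintype.card_pos_iff.2 ⟨b⟩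
    simp only [labelWeight]; positivity
  · have : 0 < Fintype.card A := Fintype.card_pos_iff.2 ⟨a⟩
    simp only [labelWeight]; positivity

lemma labelWeight_nonneg (l : Option A × Option B) : 0 ≤ labelWeight l := by
  obtain ⟨_ | a, _ | b⟩ := l <;> simp [labelWeight]

open Classical in
lemma card_lsupp_eq_mul_labelWeight {l : Option A × Option B}
    (h : lsupp l = (true, false) ∨ lsupp l = (false, true)) :
    (((Finset.univ.filter fun l' : Option A × Option B => lsupp l' = lsupp l).card : ℕ) : ℝ) *
      labelWeight l = 1 := by
  have hpos := labelWeight_pos h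
  obtain ⟨_ | a, _ | b⟩ := l <;> simp [lsupp] at h
  · have : (Finset.univ.filter fun l' : Option A × Option B =>
        lsupp l' = lsupp ((none, some b) : Option A × Option B)) =
          Finset.univ.image fun b : B => (none, some b) := by
      ext ⟨_ | a, _ | b⟩ <;> simp [lsupp]
    rw [this, Finset.card_image_of_injective _ fun b b' h => by simpa using h,
      Finset.card_univ]
    simp only [labelWeight] at hpos ⊢
    exact mul_inv_cancel₀ (inv_pos.1 hpos).ne'
  · have : (Finset.univ.filter fun l' : Option A × Option B =>
        lsupp l' = lsupp ((some a, none) : Option A × Option B)) =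
          Finset.univ.image fun a : A => (some a, none) := by
      ext ⟨_ | a, _ | b⟩ <;> simp [lsupp]
    rw [this, Finset.card_image_of_injective _ fun b b' h => by simpa using h,
      Finset.card_univ]
    simp only [labelWeight] at hpos ⊢
    exact mul_inv_cancel₀ (inv_pos.1 hpos).ne'

open Classical in
lemma markovOf_eq_sum {S : Type*} (T : Set (S × (Option A × Option B) × S)) (p q : S) :
    markovOf T p q = ∑ l, if (p, l, q) ∈ T then labelWeight l else 0 := by
  have h1 : (Nat.card {a : A | (p, (some a, none), q) ∈ T} : ℝ) =
      ∑ a, if (p, ((some a, none) : Option A × Option B), q) ∈ T then 1 else 0 := by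
    rw [Finset.sum_boole, Nat.card_eq_fintype_card, Fintype.card_subtype]; simp
  have h2 : (Nat.card {b : B | (p, (none, some b), q) ∈ T} : ℝ) =
      ∑ b, if (p, ((none, some b) : Option A × Option B), q) ∈ T then 1 else 0 := by
    rw [Finset.sum_boole, Nat.card_eq_fintype_card, Fintype.card_subtype]; simp
  rw [markovOf, h1, h2, Fintype.sum_prod_type, Fintype.sum_option, Fintype.sum_option]
  simp only [Fintype.sum_option, labelWeight, ite_self, Finset.sum_const_zero, add_zero,
    zero_add, div_eq_mul_inv, Finset.sum_mul, ite_mul, one_mul, zero_mul]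
  rw [add_comm]

variable {M : TwoAut A B Q}

lemma markovOf_nonneg {S : Type*} (T : Set (S × (Option A × Option B) × S)) (p q : S) :
    0 ≤ markovOf T p q := by
  unfold markovOf; positivity

lemma markovOf_pos (hM : M.OneSymbol) {p q : Q} (h : M.Step p q) :
    0 < markovOf M.trans p q := by
  classical
  obtain ⟨l, hl⟩ := h
  rw [markovOf_eq_sum]
  refine Finset.sum_pos' (fun l _ => ?_) ⟨l, Finset.mem_univ _, ?_⟩
  · split_ifs
    exacts [labelWeight_nonneg l, le_rfl]
  · rw [if_pos hl]
    exact labelWeight_pos (hM _ hl)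

variable [Fintype Q]

lemma pos_of_invariant (hM : M.OneSymbol) (hS : M.StronglyConnected) {v : Q → ℝ}
    (hv : ∀ q, 0 ≤ v q) (hinv : ∀ q, ∑ p, v p * markovOf M.trans p q = v q) {p : Q}
    (hp : 0 < v p) (q : Q) : 0 < v q := by
  induction hS p q with
  | refl => exact hp
  | @tail b c _ hstep ih =>
    rw [← hinv c]
    exact Finset.sum_pos' (fun p _ => mul_nonneg (hv p) (markovOf_nonneg _ _ _))
      ⟨b, Finset.mem_univ _, mul_pos ih (markovOf_pos hM hstep)⟩

lemma TwoAut.IsStationary.pos (hM : M.OneSymbol) (hS : M.StronglyConnected) {v : Q → ℝ}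
    (hv : M.IsStationary v) (q : Q) : 0 < v q := by
  obtain ⟨h0, h1, h2⟩ := hv
  obtain ⟨p, -, hp⟩ : ∃ p ∈ Finset.univ, 0 < v p := by
    by_contra! h
    have := Finset.sum_nonpos h
    linarith
  exact pos_of_invariant hM hS (fun q => h0 q (Finset.mem_univ _))
    (fun q => h2 q (Finset.mem_univ _)) hp q

lemma TwoAut.IsStationary.unique (hM : M.OneSymbol) (hS : M.StronglyConnected) {v w : Q → ℝ}
    (hv : M.IsStationary v) (hw : M.IsStationary w) : v = w := by
  have hwpos := hw.pos hM hS
  obtain ⟨h0, h1, h2⟩ := hv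
  obtain ⟨h0', h1', h2'⟩ := hw
  have hne : (Finset.univ : Finset Q).Nonempty := by
    by_contra h
    rw [Finset.not_nonempty_iff_eq_empty] at h
    rw [h] at h1
    simp at h1
  obtain ⟨q₀, -, hmin⟩ := Finset.exists_min_image Finset.univ (fun q => v q / w q) hne
  set t := v q₀ / w q₀ with ht
  have hnn : ∀ q, 0 ≤ v q - t * w q := fun q => by
    have := (le_div_iff₀ (hwpos q)).1 (hmin q (Finset.mem_univ _))
    linarith
  have hinv : ∀ q, ∑ p, (v p - t * w p) * markovOf M.trans p q = v q - t * w q := fun q => by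
    rw [← h2 q (Finset.mem_univ _), ← h2' q (Finset.mem_univ _), Finset.mul_sum,
      ← Finset.sum_sub_distrib]
    exact Finset.sum_congr rfl fun p _ => by ring
  have hzero : ∀ q, v q - t * w q = 0 := fun q => by
    by_contra hq
    have := pos_of_invariant hM hS hnn hinv (lt_of_le_of_ne (hnn q) (Ne.symm hq)) q₀
    rw [ht, div_mul_cancel₀ _ (hwpos q₀).ne'] at this
    simp at this
  have ht1 : t = 1 := by
    have : ∑ q, v q = t * ∑ q, w q := by
      rw [Finset.mul_sum]
      exact Finset.sum_congr rfl fun q _ => by linarith [hzero q]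
    rw [h1, h1', mul_one] at this
    exact this.symm
  funext q
  have := hzero q
  rw [ht1] at this
  linarith

end Weights

section Completion

variable (M : TwoAut A B Q)

/-- The transitions of `M`, completed by loops for the missing labels. -/
def completedTrans : Set (Q × (Option A × Option B) × Q) :=
  M.trans ∪ {t | t.1 = t.2.2 ∧ (∃ t' ∈ M.trans, t'.1 = t.1 ∧ lsupp t'.2.1 = lsupp t.2.1) ∧
    ∀ q, (t.1, t.2.1, q) ∉ M.trans}

variable {M}

lemma exists_lsupp_eq_of_mem_completedTrans {t : Q × (Option A × Option B) × Q}
    (ht : t ∈ completedTrans M) :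
    ∃ t' ∈ M.trans, t'.1 = t.1 ∧ lsupp t'.2.1 = lsupp t.2.1 := by
  rcases ht with ht | ht
  · exact ⟨t, ht, rfl, rfl⟩
  · exact ht.2.1

lemma exists_mem_completedTrans {t : Q × (Option A × Option B) × Q} (ht : t ∈ M.trans)
    {l : Option A × Option B} (hl : lsupp l = lsupp t.2.1) :
    ∃ q, (t.1, l, q) ∈ completedTrans M := by
  by_cases h : ∃ q, (t.1, l, q) ∈ M.trans
  · exact h.imp fun q hq => Or.inl hq
  · exact ⟨t.1, Or.inr ⟨rfl, ⟨t, ht, rfl, hl.symm⟩, not_exists.1 h⟩⟩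

lemma completedTrans_det (hM : M.TwoDet) :
    ∀ t ∈ completedTrans M, ∀ t' ∈ completedTrans M, t.1 = t'.1 →
      lsupp t.2.1 = lsupp t'.2.1 ∧ (t.2.1 = t'.2.1 → t = t') := by
  intro t ht t' ht' h
  constructor
  · obtain ⟨s, hs, hs1, hs2⟩ := exists_lsupp_eq_of_mem_completedTrans ht
    obtain ⟨s', hs', hs1', hs2'⟩ := exists_lsupp_eq_of_mem_completedTrans ht'
    rw [← hs2, ← hs2']
    exact (hM.2 s hs s' hs' (by rw [hs1, hs1', h])).1
  · obtain ⟨p, l, q⟩ := t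
    obtain ⟨p', l', q'⟩ := t'
    rintro hl
    dsimp only at h hl
    subst h hl
    rcases ht with ht | ht <;> rcases ht' with ht' | ht'
    · exact (hM.2 _ ht _ ht' rfl).2 rfl
    · exact absurd ht (ht'.2.2 q)
    · exact absurd ht' (ht.2.2 q')
    · have h1 := ht.1
      have h2 := ht'.1
      dsimp only at h1 h2
      rw [← h1, ← h2]

open Classical in
lemma card_completedTrans_mul_labelWeight [Fintype A] [Fintype B] [Fintype Q] (hM : M.TwoDet)
    (hM' : M.OneSymbol) {t : Q × (Option A × Option B) × Q} (ht : t ∈ M.trans) :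
    (((Finset.univ.filter fun τ => τ ∈ completedTrans M ∧ τ.1 = t.1).card : ℕ) : ℝ) *
      labelWeight t.2.1 = 1 := by
  rw [← card_lsupp_eq_mul_labelWeight (hM' t ht)]
  congr 2
  refine Finset.card_bij (fun τ _ => τ.2.1) ?_ ?_ ?_
  · intro τ hτ
    simp only [Finset.mem_filter, Finset.mem_univ, true_and] at hτ ⊢
    exact (completedTrans_det hM τ hτ.1 t (Or.inl ht) hτ.2).1
  · intro τ hτ τ' hτ' h
    simp only [Finset.mem_filter, Finset.mem_univ, true_and] at hτ hτ'
    exact (completedTrans_det hM τ hτ.1 τ' hτ'.1 (hτ.2.trans hτ'.2.symm)).2 h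
  · intro l hl
    simp only [Finset.mem_filter, Finset.mem_univ, true_and] at hl
    obtain ⟨q, hq⟩ := exists_mem_completedTrans ht hl
    exact ⟨(t.1, l, q), by simpa using hq, rfl⟩

end Completion

lemma exists_run_from_of_tendsto_pos {γ : ℕ → Q × (Option A × Option B) × Q} {k : ℕ → ℕ}
    {p : Q} {L : ℝ} (hL : 0 < L)
    (hlim : Tendsto (fun n => (stateCount γ p (k n) : ℝ) / (k n)) atTop (𝓝 L)) :
    (∀ᶠ n in atTop, (stateCount γ p (k n) : ℝ) ≠ 0) ∧ ∃ i, (γ i).1 = p := by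
  have hev : ∀ᶠ n in atTop, (stateCount γ p (k n) : ℝ) ≠ 0 := by
    filter_upwards [hlim.eventually (lt_mem_nhds hL)] with n hn h
    simp [h] at hn
  refine ⟨hev, ?_⟩
  obtain ⟨n, hn⟩ := hev.exists
  by_contra! h
  refine hn ?_
  have : {i : ℕ | i < k n ∧ (γ i).1 = p} = ∅ :=
    Set.eq_empty_of_forall_notMem fun i hi => h i hi.2
  rw [stateCount, this]
  simp

section Limits

variable [Fintype A] [Fintype B] {Q : Type} [Fintype Q] {M : TwoAut A B Q}
  {γ : ℕ → Q × (Option A × Option B) × Q} {x : ℕ → A} {y : ℕ → B}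

/-- At a state of positive limiting frequency, every transition of the completion has relative
frequency given by its weight. -/
lemma tendsto_transCount_div_stateCount (H : EquiTrans x y) (hM : M.TwoDet)
    (hM' : M.OneSymbol) (hγ : M.IsRunOn γ x y) {k : ℕ → ℕ} (hk : StrictMono k) {L : ℝ}
    (hL : 0 < L) {σ : Q × (Option A × Option B) × Q} (hσ : σ ∈ completedTrans M)
    (hlim : Tendsto (fun n => (stateCount γ σ.1 (k n) : ℝ) / (k n)) atTop (𝓝 L)) :
    Tendsto (fun n => (transCount γ σ (k n) : ℝ) / (stateCount γ σ.1 (k n))) atTop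
      (𝓝 (labelWeight σ.2.1)) := by
  classical
  have hdet := completedTrans_det hM
  have hrunT : ∀ n, γ n ∈ completedTrans M := fun n => Or.inl (hγ.1 n)
  have hrun : TwoAut.IsRunOn ⟨{(γ 0).1}, completedTrans M⟩ γ x y := ⟨hrunT, hγ.2⟩
  obtain ⟨hev, i, hi⟩ := exists_run_from_of_tendsto_pos hL hlim
  have hEq := fun σ' hσ' h => H Q (completedTrans M) hdet γ hrun σ hσ σ' hσ' h k hk L hL hlim
  obtain ⟨c, hc, -⟩ := hEq σ hσ rfl
  have hall : ∀ τ ∈ Finset.univ.filter (fun τ => τ ∈ completedTrans M ∧ τ.1 = σ.1),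
      Tendsto (fun n => (transCount γ τ (k n) : ℝ) / (stateCount γ σ.1 (k n))) atTop (𝓝 c) := by
    intro τ hτ
    simp only [Finset.mem_filter, Finset.mem_univ, true_and] at hτ
    obtain ⟨c', h1, h2⟩ := hEq τ hτ.1 hτ.2.symm
    rwa [tendsto_nhds_unique hc h1]
  have hsum := tendsto_finsetSum _ hall
  have hone : Tendsto (fun n => ∑ τ with τ ∈ completedTrans M ∧ τ.1 = σ.1,
      (transCount γ τ (k n) : ℝ) / (stateCount γ σ.1 (k n))) atTop (𝓝 1) := by
    refine tendsto_const_nhds.congr' ?_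
    filter_upwards [hev] with n hn
    rw [← Finset.sum_div, eq_comm, div_eq_one_iff_eq hn, stateCount_eq_sum_transCount,
      Nat.cast_sum]
    refine Finset.sum_subset (fun τ hτ => ?_) (fun τ hτ hτ' => ?_)
    · simp only [Finset.mem_filter, Finset.mem_univ, true_and] at hτ ⊢
      exact hτ.2
    · simp only [Finset.mem_filter, Finset.mem_univ, true_and] at hτ hτ'
      rw [transCount_eq_zero hrunT fun h => hτ' ⟨h, hτ⟩, Nat.cast_zero]
  have hcard := tendsto_nhds_unique hsum hone
  rw [Finset.sum_const, nsmul_eq_mul] at hcard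
  have hw := card_completedTrans_mul_labelWeight hM hM' (hγ.1 i)
  rw [hi] at hw
  have hww : labelWeight σ.2.1 = labelWeight (γ i).2.1 := by
    have h := (hdet σ hσ (γ i) (hrunT i) hi.symm).1
    generalize σ.2.1 = l at h
    generalize (γ i).2.1 = l' at h
    obtain ⟨_ | a, _ | b⟩ := l <;> obtain ⟨_ | a', _ | b'⟩ := l' <;>
      simp [lsupp] at h <;> rfl
  rw [hww]
  have hne := left_ne_zero_of_mul_eq_one hw
  rwa [← mul_left_cancel₀ hne (hcard.trans hw.symm)]

lemma tendsto_transCount_div_s6 (H : EquiTrans x y) (hM : M.TwoDet)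
    (hM' : M.OneSymbol) (hγ : M.IsRunOn γ x y) {k : ℕ → ℕ} (hk : StrictMono k) {L : ℝ}
    {σ : Q × (Option A × Option B) × Q} (hσ : σ ∈ completedTrans M)
    (hlim : Tendsto (fun n => (stateCount γ σ.1 (k n) : ℝ) / (k n)) atTop (𝓝 L)) :
    Tendsto (fun n => (transCount γ σ (k n) : ℝ) / (k n)) atTop
      (𝓝 (L * labelWeight σ.2.1)) := by
  have hL : 0 ≤ L := ge_of_tendsto' hlim fun n => by positivity
  rcases hL.eq_or_lt with rfl | hL
  · rw [zero_mul]
    refine squeeze_zero (fun n => by positivity) (fun n => ?_) hlim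
    gcongr
    exact transCount_le_stateCount γ σ (k n)
  · refine (hlim.mul (tendsto_transCount_div_stateCount H hM hM' hγ hk hL hσ hlim)).congr' ?_
    filter_upwards [(exists_run_from_of_tendsto_pos hL hlim).1] with n hn
    rw [div_mul_div_comm, mul_comm (k n : ℝ), mul_div_mul_left _ _ hn]

lemma isStationary_of_tendsto (H : EquiTrans x y) (hM : M.TwoDet)
    (hM' : M.OneSymbol) (hγ : M.IsRunOn γ x y) {k : ℕ → ℕ} (hk : StrictMono k) {L : Q → ℝ}
    (hlim : ∀ q, Tendsto (fun n => (stateCount γ q (k n) : ℝ) / (k n)) atTop (𝓝 (L q))) :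
    M.IsStationary L := by
  classical
  refine ⟨fun q _ => ge_of_tendsto' (hlim q) fun n => by positivity, ?_, fun q _ => ?_⟩
  · refine tendsto_nhds_unique (tendsto_finsetSum Finset.univ fun q _ => hlim q) ?_
    refine tendsto_const_nhds.congr' ?_
    filter_upwards [hk.tendsto_atTop.eventually_gt_atTop 0] with n hn
    rw [← Finset.sum_div, ← Nat.cast_sum, sum_stateCount, div_self (by positivity)]
  · have hin : Tendsto (fun n => ∑ τ with τ.2.2 = q, (transCount γ τ (k n) : ℝ) / (k n)) atTop
        (𝓝 (∑ τ with τ.2.2 = q, if τ ∈ M.trans then L τ.1 * labelWeight τ.2.1 else 0)) := by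
      refine tendsto_finsetSum _ fun τ _ => ?_
      split_ifs with hτ
      · exact tendsto_transCount_div_s6 H hM hM' hγ hk (Or.inl hτ) (hlim _)
      · simp [transCount_eq_zero hγ.1 hτ]
    have heq : (∑ τ with τ.2.2 = q, if τ ∈ M.trans then L τ.1 * labelWeight τ.2.1 else 0) =
        ∑ p, L p * markovOf M.trans p q := by
      simp only [Finset.sum_filter, Fintype.sum_prod_type (α₁ := Q), markovOf_eq_sum,
        Finset.mul_sum]
      refine Finset.sum_congr rfl fun p _ => ?_
      rw [Fintype.sum_prod_type]
      exact Finset.sum_congr rfl fun l _ => by simp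
    rw [heq] at hin
    refine tendsto_nhds_unique hin ?_
    have hinv : Tendsto (fun n => (1 : ℝ) / (k n)) atTop (𝓝 0) :=
      tendsto_one_div_atTop_nhds_zero_nat.comp hk.tendsto_atTop
    rw [tendsto_iff_of_dist (f₂ := fun n => (stateCount γ q (k n) : ℝ) / (k n)) ?_]
    · exact hlim q
    · refine squeeze_zero (fun n => dist_nonneg) (fun n => ?_) hinv
      rw [← Finset.sum_div, ← Nat.cast_sum, Real.dist_eq, ← sub_div, abs_div, Nat.abs_cast]
      gcongr
      have h1 := stateCount_succ_eq_sum_transCount hγ.2.1 q (k n)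
      have h2 : stateCount γ q (k n + 1) =
          stateCount γ q (k n) + if (γ (k n)).1 = q then 1 else 0 := by
        simp [stateCount_eq_count, Nat.count_succ]
      have h3 : (∑ τ with τ.2.2 = q, transCount γ τ (k n)) + (if (γ 0).1 = q then 1 else 0) =
          stateCount γ q (k n) + if (γ (k n)).1 = q then 1 else 0 := by rw [← h1, h2]
      have h4 : ((∑ τ with τ.2.2 = q, transCount γ τ (k n) : ℕ) : ℝ) +
          (if (γ 0).1 = q then 1 else 0) =
          stateCount γ q (k n) + if (γ (k n)).1 = q then 1 else 0 := by exact_mod_cast h3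
      rw [abs_le]
      split_ifs at h4 <;> constructor <;> linarith

lemma twoComplete_of_tendsto (H : EquiTrans x y) (hM : M.TwoDet) (hM' : M.OneSymbol)
    (hγ : M.IsRunOn γ x y) {k : ℕ → ℕ} (hk : StrictMono k) {L : Q → ℝ} (hL : ∀ q, 0 < L q)
    (hlim : ∀ q, Tendsto (fun n => (stateCount γ q (k n) : ℝ) / (k n)) atTop (𝓝 (L q))) :
    M.TwoComplete := by
  rintro q l l' ⟨q', hq'⟩ hl
  by_contra h
  obtain ⟨r, hr⟩ := exists_mem_completedTrans hq' hl
  have hnot : (q, l', r) ∉ M.trans := fun h' => h ⟨r, h'⟩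
  have hlim' := tendsto_transCount_div_stateCount H hM hM' hγ hk (hL q) hr (hlim q)
  simp only [transCount_eq_zero hγ.1 hnot, Nat.cast_zero, zero_div] at hlim'
  have hpos : 0 < labelWeight l' := labelWeight_pos (by rw [hl]; exact hM' _ hq')
  exact hpos.ne (tendsto_nhds_unique tendsto_const_nhds hlim')

theorem EquiTrans.twoComplete_and_tendsto (H : EquiTrans x y) (hM : M.TwoDet)
    (hM' : M.OneSymbol) (hS : M.StronglyConnected) (hγ : M.IsRunOn γ x y) :
    M.TwoComplete ∧ ∃ π : Q → ℝ, M.IsStationary π ∧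
      ∀ q, Tendsto (fun n : ℕ => (stateCount γ q n : ℝ) / n) atTop (𝓝 (π q)) := by
  set f : ℕ → Q → ℝ := fun n q => (stateCount γ q n : ℝ) / n with hf
  have hK : IsCompact (Set.univ.pi fun _ : Q => Set.Icc (0 : ℝ) 1) :=
    isCompact_univ_pi fun _ => isCompact_Icc
  have hmem : ∀ n, f n ∈ Set.univ.pi fun _ : Q => Set.Icc (0 : ℝ) 1 := fun n q _ =>
    ⟨by positivity, div_le_one_of_le₀ (by exact_mod_cast stateCount_le γ q n) (by positivity)⟩
  obtain ⟨π, -, k, hk, hlim⟩ := hK.tendsto_subseq hmem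
  have hlim' := tendsto_pi_nhds.1 hlim
  have hπ : M.IsStationary π := isStationary_of_tendsto H hM hM' hγ hk hlim'
  refine ⟨twoComplete_of_tendsto H hM hM' hγ hk (hπ.pos hM' hS) hlim', π, hπ, ?_⟩
  refine (tendsto_pi_nhds (f := f)).1 (hK.tendsto_nhds_of_unique_mapClusterPt
    (Eventually.of_forall hmem) fun v _ hv => ?_)
  obtain ⟨ψ, hψ, hvlim⟩ := MapClusterPt.tendsto_subseq hv
  exact (isStationary_of_tendsto H hM hM' hγ hψ (tendsto_pi_nhds.1 hvlim)).unique hM' hS hπ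

end Limits

/-- If, for every `2`-deterministic `2`-automaton and run on the
normal words `x` and `y`, any two transitions leaving a state of positive limiting
frequency occur with the same limiting relative frequency, then the frequency
property holds for `x` and `y`. -/
theorem freqProp_of_freq_trans {A B : Type*} [Fintype A] [Fintype B]
    (x : ℕ → A) (y : ℕ → B) (hx : Normal x) (hy : Normal y)
    (H : ∀ (Q : Type) [Fintype Q] (M : TwoAut A B Q), M.TwoDet →
      ∀ γ : ℕ → Q × (Option A × Option B) × Q,
        (γ 0).1 ∈ M.init → M.IsRunOn γ x y →
        ∀ (p : Q) (σ σ' : Q × (Option A × Option B) × Q),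
          σ ∈ M.trans → σ' ∈ M.trans → σ.1 = p → σ'.1 = p →
        ∀ k : ℕ → ℕ, StrictMono k →
        ∀ L : ℝ, 0 < L →
          Tendsto (fun n => (stateCount γ p (k n) : ℝ) / (k n)) atTop (nhds L) →
          ∃ c : ℝ,
            Tendsto (fun n => (transCount γ σ (k n) : ℝ) / (stateCount γ p (k n)))
              atTop (nhds c) ∧
            Tendsto (fun n => (transCount γ σ' (k n) : ℝ) / (stateCount γ p (k n)))
              atTop (nhds c)) :
    FreqProp x y := by
  have hE : EquiTrans x y := by
    intro Q _ T hT γ hγ σ hσ σ' hσ' hp k hk L hL hlim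
    exact H Q ⟨{(γ 0).1}, T⟩ ⟨⟨_, rfl⟩, hT⟩ γ rfl hγ σ.1 σ σ' hσ hσ' rfl hp.symm k hk L hL hlim
  intro Q' _ M hM hM' hS i j γ hγ
  exact (hE.suffix i j).twoComplete_and_tendsto hM hM' hS hγ

end FSI
end

section
/- Let x and y be normal infinite words over finite alphabets A and B satisfying the frequency property: for every strongly connected 2-deterministic 2-automaton 𝒜 and every infinite run γ of 𝒜 whose two inputs are a suffix of x and a suffix of y, 𝒜 is 2-complete and for every state q, lim_{n→∞} occ(γ[1..n],q)/n = π(q), where π is the stationary distribution associated with 𝒜. Then every infinite run in any 2-deterministic 2-automaton on x and y reaches a final strongly connected component, that is, a strongly connected component of the automaton which no transition leaves. -/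
open Filter Topology

namespace FSI

variable {A B D Q : Type*}

/-! ### Reading an infinite word symbol by symbol -/

/-- The sequence of optional symbols `o` spells the infinite word `x` read from position `c 0` on,
where `c n` is the position reached after `n` steps. -/
structure Reads (o : ℕ → Option A) (x : ℕ → A) (c : ℕ → ℕ) : Prop where
  of_none : ∀ n, o n = none → c (n + 1) = c n
  of_some : ∀ n a, o n = some a → x (c n) = a ∧ c (n + 1) = c n + 1
  tendsto : Tendsto c atTop atTop

theorem reduceOption_map_range_succ (o : ℕ → Option A) (n : ℕ) :
    ((List.range (n + 1)).map o).reduceOption =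
      ((List.range n).map o).reduceOption ++ (o n).toList := by
  rw [List.range_succ, List.map_append, List.reduceOption_append]
  cases h : o n <;> simp [h, List.reduceOption]

theorem reads_of_reduceOption {o : ℕ → Option A} {x : ℕ → A}
    (h : ∀ n, ((List.range n).map o).reduceOption =
      pref x ((List.range n).map o).reduceOption.length)
    (ht : Tendsto (fun n => ((List.range n).map o).reduceOption.length) atTop atTop) :
    Reads o x fun n => ((List.range n).map o).reduceOption.length where
  of_none n hn := by simp only [reduceOption_map_range_succ, hn]; simp
  of_some n a hn := by
    have h₁ := h (n + 1)
    rw [reduceOption_map_range_succ, hn] at h₁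
    simp only [Option.toList_some, List.length_append, List.length_singleton, pref_succ] at h₁
    rw [← h n] at h₁
    refine ⟨by simpa using h₁.symm, ?_⟩
    simp only [reduceOption_map_range_succ, hn]
    simp
  tendsto := ht

theorem Reads.reduceOption_eq {o : ℕ → Option A} {x : ℕ → A} {c : ℕ → ℕ} (h : Reads o x c) (n : ℕ) :
    ((List.range n).map o).reduceOption.length + c 0 = c n ∧
    ((List.range n).map o).reduceOption =
      pref (fun m => x (m + c 0)) ((List.range n).map o).reduceOption.length := by
  induction n with
  | zero => simp [pref, List.reduceOption]
  | succ n ih =>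
    obtain ⟨h₁, h₂⟩ := ih
    rw [reduceOption_map_range_succ]
    cases hn : o n with
    | none =>
      rw [h.of_none n hn]
      simpa using ⟨h₁, h₂⟩
    | some a =>
      obtain ⟨ha, hc⟩ := h.of_some n a hn
      simp only [Option.toList_some, List.length_append, List.length_singleton, pref_succ]
      rw [← h₂, h₁, ha, hc]
      exact ⟨by omega, rfl⟩

theorem Reads.tendsto_length {o : ℕ → Option A} {x : ℕ → A} {c : ℕ → ℕ} (h : Reads o x c) :
    Tendsto (fun n => ((List.range n).map o).reduceOption.length) atTop atTop := by
  refine tendsto_atTop.2 fun b => (tendsto_atTop.1 h.tendsto (b + c 0)).mono fun n hn => ?_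
  have := (h.reduceOption_eq n).1
  omega

theorem Reads.shift {o : ℕ → Option A} {x : ℕ → A} {c : ℕ → ℕ} (h : Reads o x c) (k : ℕ) :
    Reads (fun n => o (n + k)) x (fun n => c (n + k)) where
  of_none n hn := by simpa only [Nat.add_right_comm] using h.of_none (n + k) hn
  of_some n a hn := by simpa only [Nat.add_right_comm] using h.of_some (n + k) a hn
  tendsto := (tendsto_add_atTop_iff_nat k).2 h.tendsto

theorem Reads.add_eq {o : ℕ → Option A} {x : ℕ → A} {c : ℕ → ℕ} (h : Reads o x c) (a d : ℕ)
    (hd : ∀ t < d, o (a + t) = none) : c (a + d) = c a := by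
  induction d with
  | zero => rfl
  | succ d ih =>
    rw [← Nat.add_assoc, h.of_none _ (hd d d.lt_succ_self), ih fun t ht => hd t (by omega)]

theorem Reads.comp {o : ℕ → Option A} {x : ℕ → A} {c : ℕ → ℕ} (h : Reads o x c) {τ : ℕ → ℕ}
    (hτ : StrictMono τ) (hgap : ∀ k t, τ k < t → t < τ (k + 1) → o t = none) :
    Reads (fun k => o (τ k)) x (fun k => c (τ k)) := by
  have hc : ∀ k, c (τ (k + 1)) = c (τ k + 1) := fun k => by
    have hlt : τ k < τ (k + 1) := hτ k.lt_succ_self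
    have := h.add_eq (τ k + 1) (τ (k + 1) - (τ k + 1)) fun t ht =>
      hgap k _ (by omega) (by omega)
    rwa [Nat.add_sub_cancel' hlt] at this
  exact ⟨fun k hk => (hc k).trans (h.of_none _ hk),
    fun k a hk => (h.of_some _ a hk).imp_right (hc k).trans, h.tendsto.comp hτ.tendsto_atTop⟩

theorem Reads.exists_isSome {o : ℕ → Option A} {x : ℕ → A} {c : ℕ → ℕ} (h : Reads o x c) (N : ℕ) :
    ∃ n ≥ N, o n ≠ none := by
  by_contra! hN
  obtain ⟨n, hn⟩ := ((tendsto_atTop.1 h.tendsto (c N + 1)).and (eventually_ge_atTop N)).exists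
  have := h.add_eq N (n - N) fun t _ => hN _ (by omega)
  rw [Nat.add_sub_cancel' hn.2] at this
  omega

/-! ### Deterministic sequences of states and labels -/

/-- The state and the label determine the next state, and the state determines the support of the
label. -/
def DetSeq {S : Type*} (s : ℕ → S) (l : ℕ → Option A × Option B) : Prop :=
  ∀ i j, s i = s j → lsupp (l i) = lsupp (l j) ∧ (l i = l j → s (i + 1) = s (j + 1))

theorem lsupp_eq_false {l : Option A × Option B} : lsupp l = (false, false) ↔ l = (none, none) := by
  obtain ⟨_ | _, _ | _⟩ := l <;> simp [lsupp]

theorem DetSeq.add_eq {S : Type*} {s : ℕ → S} {l : ℕ → Option A × Option B} (hdet : DetSeq s l)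
    (k : ℕ) {a b : ℕ} (hab : s a = s b) (hk : ∀ t < k, l (a + t) = (none, none)) :
    s (a + k) = s (b + k) ∧ ∀ t < k, l (b + t) = (none, none) := by
  induction k with
  | zero => exact ⟨hab, fun t ht => absurd ht t.not_lt_zero⟩
  | succ k ih =>
    obtain ⟨h₁, h₂⟩ := ih fun t ht => hk t (by omega)
    have ha := hk k k.lt_succ_self
    have hb : l (b + k) = (none, none) :=
      lsupp_eq_false.1 ((hdet _ _ h₁).1.symm.trans (lsupp_eq_false.2 ha))
    refine ⟨(hdet _ _ h₁).2 (ha.trans hb.symm), fun t ht => ?_⟩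
    obtain ht | rfl := Nat.lt_succ_iff_lt_or_eq.1 ht
    exacts [h₂ t ht, hb]

theorem DetSeq.comp {S : Type*} {s : ℕ → S} {l : ℕ → Option A × Option B} (hdet : DetSeq s l)
    {τ : ℕ → ℕ} (hτ : StrictMono τ) (hne : ∀ k, l (τ k) ≠ (none, none))
    (hgap : ∀ k t, τ k < t → t < τ (k + 1) → l t = (none, none)) :
    DetSeq (fun k => s (τ k)) (fun k => l (τ k)) := by
  refine fun i j hij => ⟨(hdet _ _ hij).1, fun hl => ?_⟩
  have hi : τ i < τ (i + 1) := hτ i.lt_succ_self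
  have hj : τ j < τ (j + 1) := hτ j.lt_succ_self
  obtain ⟨k, hk⟩ := Nat.exists_eq_add_of_lt hi
  obtain ⟨k', hk'⟩ := Nat.exists_eq_add_of_lt hj
  have hs := (hdet _ _ hij).2 hl
  obtain hkk | rfl | hkk := lt_trichotomy k k'
  · have h := (hdet.add_eq k hs fun t ht => hgap i _ (by omega) (by omega)).1
    have hl' := (hdet _ _ h).1
    rw [hgap j (τ j + 1 + k) (by omega) (by omega), lsupp_eq_false.2 rfl, lsupp_eq_false] at hl'
    exact absurd hl' (by simpa [hk, Nat.add_right_comm] using hne (i + 1))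
  · have h := (hdet.add_eq k hs fun t ht => hgap i _ (by omega) (by omega)).1
    simpa only [hk, hk', Nat.add_right_comm] using h
  · have h := (hdet.add_eq k' hs fun t ht => hgap i _ (by omega) (by omega)).1
    have hl' := (hdet _ _ h).1
    rw [hgap i (τ i + 1 + k') (by omega) (by omega), lsupp_eq_false.2 rfl, eq_comm,
      lsupp_eq_false] at hl'
    exact absurd hl' (by simpa [hk', Nat.add_right_comm] using hne (j + 1))

/-- A sequence in a finite type eventually takes only values that it takes infinitely often. -/
theorem exists_forall_ge_recurrent {S : Type*} [Finite S] (s : ℕ → S) :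
    ∃ K, ∀ i ≥ K, ∀ N, ∃ j ≥ N, s j = s i := by
  have h : ∀ᶠ i in atTop, ∀ q : S, (∀ᶠ j in atTop, s j ≠ q) → s i ≠ q := by
    refine eventually_all.2 fun q => ?_
    by_cases hq : ∀ᶠ j in atTop, s j ≠ q
    · exact hq.mono fun i hi _ => hi
    · exact Eventually.of_forall fun i hi => absurd hi hq
  obtain ⟨K, hK⟩ := eventually_atTop.1 h
  refine ⟨K, fun i hi N => ?_⟩
  by_contra! hN
  exact hK i hi (s i) (eventually_atTop.2 ⟨N, hN⟩) rfl

theorem TwoAut.reaches_of_seq (M : TwoAut A B Q) {s : ℕ → Q} (h : ∀ n, M.Step (s n) (s (n + 1)))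
    {i j : ℕ} (hij : i ≤ j) : M.Reaches (s i) (s j) := by
  induction j, hij using Nat.le_induction with
  | base => exact .refl
  | succ j _ ih => exact ih.tail (h j)

section FrequencyProperty

variable [Fintype A] [Fintype B] {x : ℕ → A} {y : ℕ → B} {S : Type*} [Finite S]
  {s : ℕ → S} {l : ℕ → Option A × Option B} {c d : ℕ → ℕ}

theorem FreqProp.exists_label_of_recurrent (hfp : FreqProp x y) (hdet : DetSeq s l)
    (hone : ∀ i, lsupp (l i) = (true, false) ∨ lsupp (l i) = (false, true))
    (hc : Reads (fun i => (l i).1) x c) (hd : Reads (fun i => (l i).2) y d)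
    (hrec : ∀ i N, ∃ j ≥ N, s j = s i)
    (i : ℕ) (l' : Option A × Option B) (hl : lsupp l' = lsupp (l i)) :
    ∃ j, s j = s i ∧ l j = l' := by
  classical
  obtain ⟨m, ⟨e⟩⟩ := Finite.exists_equiv_fin S
  let st : ℕ → Set.range (e ∘ s) := fun i => ⟨e (s i), i, rfl⟩
  have hst : ∀ i j, st i = st j ↔ s i = s j := fun i j => Subtype.ext_iff.trans e.apply_eq_iff_eq
  have hsurj : ∀ q, ∃ i, st i = q := by
    rintro ⟨_, i, rfl⟩
    exact ⟨i, rfl⟩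
  let g := fun i => (st i, l i, st (i + 1))
  let M : TwoAut A B (Set.range (e ∘ s)) := ⟨{st 0}, Set.range g⟩
  have hM : M.TwoDet := by
    refine ⟨⟨_, rfl⟩, ?_⟩
    rintro _ ⟨i, rfl⟩ _ ⟨j, rfl⟩ hij
    obtain ⟨h₁, h₂⟩ := hdet i j ((hst i j).1 hij)
    exact ⟨h₁, fun h => Prod.ext hij (Prod.ext h ((hst _ _).2 (h₂ h)))⟩
  have hone' : M.OneSymbol := by
    rintro _ ⟨i, rfl⟩
    exact hone i
  have hsc : M.StronglyConnected := by
    intro p q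
    obtain ⟨i, rfl⟩ := hsurj p
    obtain ⟨j, rfl⟩ := hsurj q
    obtain ⟨k, hk, hkj⟩ := hrec j i
    rw [← (hst k j).2 hkj]
    exact M.reaches_of_seq (fun n => ⟨l n, n, rfl⟩) hk
  have hrun : M.IsRunOn g (fun n => x (n + c 0)) (fun n => y (n + d 0)) :=
    ⟨fun n => ⟨n, rfl⟩, fun _ => rfl, fun n => (hc.reduceOption_eq n).2,
      fun n => (hd.reduceOption_eq n).2, hc.tendsto_length, hd.tendsto_length⟩
  obtain ⟨q', j, hj⟩ := (hfp _ M hM hone' hsc _ _ g hrun).1 (st i) (l i) l'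
    ⟨_, i, rfl⟩ hl
  simp only [g, Prod.mk.injEq] at hj
  exact ⟨j, (hst _ _).1 hj.1, hj.2.1⟩

theorem FreqProp.exists_label_of_oneSymbol (hfp : FreqProp x y) (hdet : DetSeq s l)
    (hone : ∀ i, lsupp (l i) = (true, false) ∨ lsupp (l i) = (false, true))
    (hc : Reads (fun i => (l i).1) x c) (hd : Reads (fun i => (l i).2) y d) :
    ∃ K, ∀ i ≥ K, ∀ l', lsupp l' = lsupp (l i) → ∀ N, ∃ j ≥ N, s j = s i ∧ l j = l' := by
  obtain ⟨K, hK⟩ := exists_forall_ge_recurrent s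
  refine ⟨K, fun i hi l' hl N => ?_⟩
  obtain ⟨i', hi', hs⟩ := hK i hi (max K N)
  have hdet' : DetSeq (fun n => s (n + max K N)) (fun n => l (n + max K N)) := fun a b hab => by
    simpa only [Nat.add_right_comm] using hdet _ _ hab
  obtain ⟨j, hj, hj'⟩ := hfp.exists_label_of_recurrent hdet' (fun n => hone _)
    (hc.shift (max K N)) (hd.shift (max K N))
    (fun a b => by
      obtain ⟨j, hj, hj'⟩ := hK (a + max K N) (by omega) (b + max K N)
      refine ⟨j - max K N, by omega, ?_⟩
      rw [Nat.sub_add_cancel (by omega), hj'])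
    (i' - max K N) l'
    (by rw [Nat.sub_add_cancel hi', hl, (hdet _ _ hs).1])
  rw [Nat.sub_add_cancel hi', hs] at hj
  exact ⟨_, by omega, hj, hj'⟩

theorem FreqProp.exists_label (hfp : FreqProp x y) (hdet : DetSeq s l)
    (hone : ∀ i, lsupp (l i) ≠ (true, true))
    (hc : Reads (fun i => (l i).1) x c) (hd : Reads (fun i => (l i).2) y d) :
    ∃ K, ∀ i ≥ K, ∀ l', lsupp l' = lsupp (l i) → ∀ N, ∃ j ≥ N, s j = s i ∧ l j = l' := by
  classical
  obtain ⟨K₀, hK₀⟩ := exists_forall_ge_recurrent s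
  let P : ℕ → Prop := fun i => l i ≠ (none, none)
  have hinf : {i | P i}.Infinite := Set.infinite_of_not_bddAbove fun ⟨b, hb⟩ => by
    obtain ⟨n, hn, hne⟩ := hc.exists_isSome (b + 1)
    have := hb (show l n ≠ (none, none) from fun h => hne (congrArg Prod.fst h))
    omega
  have hτ : StrictMono (Nat.nth P) := Nat.nth_strictMono hinf
  have hne : ∀ k, l (Nat.nth P k) ≠ (none, none) := Nat.nth_mem_of_infinite hinf
  have hgap : ∀ k t, Nat.nth P k < t → t < Nat.nth P (k + 1) → l t = (none, none) := by
    intro k t h₁ h₂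
    by_contra h
    rw [← Nat.nth_count (p := P) h, hτ.lt_iff_lt] at h₁ h₂
    omega
  obtain ⟨K, hK⟩ := hfp.exists_label_of_oneSymbol (hdet.comp hτ hne hgap)
    (fun k => by
      have h₁ := hone (Nat.nth P k)
      have h₂ := mt lsupp_eq_false.1 (hne k)
      revert h₁ h₂
      generalize lsupp (l (Nat.nth P k)) = b
      revert b
      decide)
    (hc.comp hτ fun k t h₁ h₂ => congrArg Prod.fst (hgap k t h₁ h₂))
    (hd.comp hτ fun k t h₁ h₂ => congrArg Prod.snd (hgap k t h₁ h₂))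
  refine ⟨max K₀ (Nat.nth P K), fun i hi l' hl N => ?_⟩
  by_cases h : l i = (none, none)
  · obtain ⟨j, hj, hji⟩ := hK₀ i (by omega) N
    refine ⟨j, hj, hji, ?_⟩
    have hj' := (hdet _ _ hji).1
    rw [h, lsupp_eq_false.2 rfl, lsupp_eq_false] at hj' hl
    exact hj'.trans hl.symm
  · have hi' := Nat.nth_count (p := P) h
    have hKi : K ≤ Nat.count P i := hτ.le_iff_le.1 (by omega)
    obtain ⟨j, hj, h₁, h₂⟩ := hK _ hKi l' (by rw [hi', hl]) N
    rw [hi'] at h₁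
    exact ⟨_, hj.trans hτ.le_apply, h₁, h₂⟩

end FrequencyProperty

section SplitSteps

/-! ### Splitting each step into a step on the first tape and a step on the second tape -/

/-- The states of the run `γ` in which every transition is replaced by two: the intermediate state
remembers the symbol read on the first tape. -/
def splitState (γ : ℕ → Q × (Option A × Option B) × Q) (i : ℕ) : Q × Option (Option A) :=
  ((γ (i / 2)).1, if i % 2 = 0 then none else some (γ (i / 2)).2.1.1)

/-- The labels of the run `γ` in which every transition is replaced by two. -/
def splitLabel (γ : ℕ → Q × (Option A × Option B) × Q) (i : ℕ) : Option A × Option B :=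
  if i % 2 = 0 then ((γ (i / 2)).2.1.1, none) else (none, (γ (i / 2)).2.1.2)

variable (γ : ℕ → Q × (Option A × Option B) × Q) (n : ℕ)

theorem splitState_even : splitState γ (2 * n) = ((γ n).1, none) := by
  simp [splitState]

theorem splitState_odd : splitState γ (2 * n + 1) = ((γ n).1, some (γ n).2.1.1) := by
  simp [splitState, Nat.add_mod, show (2 * n + 1) / 2 = n by omega]

theorem splitLabel_even : splitLabel γ (2 * n) = ((γ n).2.1.1, none) := by
  simp [splitLabel]

theorem splitLabel_odd : splitLabel γ (2 * n + 1) = (none, (γ n).2.1.2) := by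
  simp [splitLabel, Nat.add_mod, show (2 * n + 1) / 2 = n by omega]

theorem lsupp_splitLabel_ne : lsupp (splitLabel γ n) ≠ (true, true) := by
  unfold splitLabel
  split_ifs <;> simp [lsupp]

variable {γ}

theorem detSeq_split {M : TwoAut A B Q} (hM : M.TwoDet) (hγ : ∀ n, γ n ∈ M.trans)
    (hnext : ∀ n, (γ n).2.2 = (γ (n + 1)).1) : DetSeq (splitState γ) (splitLabel γ) := by
  intro i j hij
  obtain ⟨m, rfl | rfl⟩ := Nat.even_or_odd' i <;> obtain ⟨n, rfl | rfl⟩ := Nat.even_or_odd' j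
  · rw [splitState_even, splitState_even, Prod.mk.injEq] at hij
    have h := (hM.2 _ (hγ m) _ (hγ n) hij.1).1
    rw [splitLabel_even, splitLabel_even, splitState_odd, splitState_odd]
    simp only [lsupp, Prod.mk.injEq] at h ⊢
    exact ⟨⟨h.1, trivial⟩, fun h' => ⟨hij.1, congrArg some h'.1⟩⟩
  · simp [splitState_even, splitState_odd] at hij
  · simp [splitState_even, splitState_odd] at hij
  · simp only [splitState_odd, Prod.mk.injEq, Option.some.injEq] at hij
    obtain ⟨h₁, h₂⟩ := hM.2 _ (hγ m) _ (hγ n) hij.1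
    rw [splitLabel_odd, splitLabel_odd, show 2 * m + 1 + 1 = 2 * (m + 1) by ring,
      show 2 * n + 1 + 1 = 2 * (n + 1) by ring, splitState_even, splitState_even]
    simp only [lsupp, Prod.mk.injEq] at h₁ ⊢
    refine ⟨⟨trivial, h₁.2⟩, fun h' => ⟨?_, trivial⟩⟩
    rw [← hnext, ← hnext, h₂ (Prod.ext hij.2 h'.2)]

theorem reads_split_fst {x : ℕ → A} {c : ℕ → ℕ} (h : Reads (fun n => (γ n).2.1.1) x c) :
    Reads (fun i => (splitLabel γ i).1) x (fun i => c ((i + 1) / 2)) where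
  of_none i hi := by
    obtain ⟨m, rfl | rfl⟩ := Nat.even_or_odd' i
    · rw [splitLabel_even] at hi
      rw [show (2 * m + 1 + 1) / 2 = m + 1 by omega, show (2 * m + 1) / 2 = m by omega]
      exact h.of_none m hi
    · congr 1
      omega
  of_some i a hi := by
    obtain ⟨m, rfl | rfl⟩ := Nat.even_or_odd' i
    · rw [splitLabel_even] at hi
      rw [show (2 * m + 1 + 1) / 2 = m + 1 by omega, show (2 * m + 1) / 2 = m by omega]
      exact h.of_some m a hi
    · simp [splitLabel_odd] at hi
  tendsto := h.tendsto.comp <| tendsto_atTop.2 fun b =>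
    (eventually_ge_atTop (2 * b)).mono fun n hn => by omega

theorem reads_split_snd {y : ℕ → B} {d : ℕ → ℕ} (h : Reads (fun n => (γ n).2.1.2) y d) :
    Reads (fun i => (splitLabel γ i).2) y (fun i => d (i / 2)) where
  of_none i hi := by
    obtain ⟨m, rfl | rfl⟩ := Nat.even_or_odd' i
    · congr 1
      omega
    · rw [splitLabel_odd] at hi
      rw [show (2 * m + 1 + 1) / 2 = m + 1 by omega, show (2 * m + 1) / 2 = m by omega]
      exact h.of_none m hi
  of_some i a hi := by
    obtain ⟨m, rfl | rfl⟩ := Nat.even_or_odd' i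
    · simp [splitLabel_even] at hi
    · rw [splitLabel_odd] at hi
      rw [show (2 * m + 1 + 1) / 2 = m + 1 by omega, show (2 * m + 1) / 2 = m by omega]
      exact h.of_some m a hi
  tendsto := h.tendsto.comp <| tendsto_atTop.2 fun b =>
    (eventually_ge_atTop (2 * b)).mono fun n hn => by omega

end SplitSteps

/-- Eventually, every transition leaving a state visited by the run is taken infinitely often. -/
theorem FreqProp.exists_transition [Fintype A] [Fintype B] {x : ℕ → A} {y : ℕ → B}
    (hfp : FreqProp x y) [Finite Q] {M : TwoAut A B Q} (hM : M.TwoDet)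
    {γ : ℕ → Q × (Option A × Option B) × Q} (hγ : M.IsRunOn γ x y) :
    ∃ K, ∀ n ≥ K, ∀ l q, ((γ n).1, l, q) ∈ M.trans →
      ∀ N, ∃ m ≥ N, γ m = ((γ n).1, l, q) := by
  obtain ⟨htr, hnext, h₁, h₂, ht₁, ht₂⟩ := hγ
  obtain ⟨K, hK⟩ := hfp.exists_label (detSeq_split hM htr hnext) (lsupp_splitLabel_ne γ)
    (reads_split_fst (reads_of_reduceOption h₁ ht₁))
    (reads_split_snd (reads_of_reduceOption h₂ ht₂))
  refine ⟨K, fun n hn l q hq N => ?_⟩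
  have hl := (hM.2 _ hq _ (htr n) rfl).1
  simp only [lsupp, Prod.mk.injEq] at hl
  obtain ⟨i, hi, hs, hl₁⟩ := hK (2 * n) (by omega) (l.1, none)
    (by simpa [splitLabel_even, lsupp] using hl.1) K
  obtain ⟨m, rfl | rfl⟩ := Nat.even_or_odd' i
  swap
  · simp [splitState_even, splitState_odd] at hs
  simp only [splitState_even, splitLabel_even, Prod.mk.injEq, and_true] at hs hl₁
  have hl' := (hM.2 _ hq _ (htr m) hs.symm).1
  simp only [lsupp, Prod.mk.injEq] at hl'
  obtain ⟨j, hj, hs', hl₂⟩ := hK (2 * m + 1) (by omega) (none, l.2)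
    (by simpa [splitLabel_odd, lsupp] using hl'.2) (2 * N)
  obtain ⟨k, rfl | rfl⟩ := Nat.even_or_odd' j
  · simp [splitState_even, splitState_odd] at hs'
  simp only [splitState_odd, splitLabel_odd, Prod.mk.injEq, Option.some.injEq, true_and]
    at hs' hl₂
  refine ⟨k, by omega, (hM.2 _ (htr k) _ hq (hs'.1.trans hs)).2 ?_⟩
  exact Prod.ext (hs'.2.trans hl₁) hl₂

/-- If the normal words `x` and `y` satisfy the frequency property,
then every infinite run of any `2`-deterministic `2`-automaton on `x` and `y` reaches
a final strongly connected component. -/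
theorem run_reaches_final_scc {A B : Type*} [Fintype A] [Fintype B]
    (x : ℕ → A) (y : ℕ → B) (hx : Normal x) (hy : Normal y) (hfp : FreqProp x y) :
    ∀ (Q : Type) [Fintype Q] (M : TwoAut A B Q), M.TwoDet →
      ∀ γ : ℕ → Q × (Option A × Option B) × Q,
        (γ 0).1 ∈ M.init → M.IsRunOn γ x y →
        ∃ n, ∀ t, M.Reaches ((γ n).1) t → M.Reaches t ((γ n).1) := by
  intro Q _ M hM γ _ hγ
  obtain ⟨K, hK⟩ := hfp.exists_transition hM hγ
  obtain ⟨K', hK'⟩ := exists_forall_ge_recurrent fun n => (γ n).1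
  refine ⟨max K K', fun t ht => ?_⟩
  have hclosed : ∃ n ≥ max K K', (γ n).1 = t := by
    induction ht with
    | refl => exact ⟨_, le_rfl, rfl⟩
    | tail _ hstep ih =>
      obtain ⟨n, hn, rfl⟩ := ih
      obtain ⟨l, hl⟩ := hstep
      obtain ⟨m, hm, hγm⟩ := hK n (by omega) l _ hl (max K K')
      exact ⟨m + 1, by omega, by rw [← hγ.2.1, hγm]⟩
  obtain ⟨n, -, rfl⟩ := hclosed
  obtain ⟨j, hj, hj'⟩ := hK' (max K K') (le_max_right _ _) n
  rw [← hj']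
  exact M.reaches_of_seq (s := fun n => (γ n).1)
    (fun i => ⟨(γ i).2.1, by rw [← hγ.2.1]; exact hγ.1 i⟩) hj

end FSI
end
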